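/- If G is a triangle-free and fork-free graph, then χ(G) ≤ ω(G) + 1, where ω(G) is the clique number of G. -/

import Mathlib

open SimpleGraph

/-- The fork: `K_{1,4}` with two edges subdivided. Vertex 0 is the center,
adjacent to leaves 1, 2 and to 3, 5; paths 0-3-4 and 0-5-6. -/
def fork : SimpleGraph (Fin 7) :=
  SimpleGraph.fromEdgeSet {s(0, 1), s(0, 2), s(0, 3), s(0, 5), s(3, 4), s(5, 6)}

/-- A graph is fork-free if it has no induced subgraph isomorphic to the fork. -/
def ForkFree {V : Type} (G : SimpleGraph V) : Prop :=
  IsEmpty (fork ↪g G)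

namespace SimpleGraph

variable {V : Type} {G : SimpleGraph V}

/-- The edge and non-edge pattern of a fork with centre `v`, leaves `a`, `b` and arms `p - p'`,
`q - q'`; in a triangle-free graph the remaining non-edges are automatic. -/
structure IsFork (G : SimpleGraph V) (v a b p p' q q' : V) : Prop where
  va : G.Adj v a
  vb : G.Adj v b
  vp : G.Adj v p
  vq : G.Adj v q
  pp : G.Adj p p'
  qq : G.Adj q q'
  ne : a ≠ b
  ap : ¬ G.Adj a p'
  bp : ¬ G.Adj b p'
  qp : ¬ G.Adj q p'
  aq : ¬ G.Adj a q'
  bq : ¬ G.Adj b q'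
  pq : ¬ G.Adj p q'
  tt : ¬ G.Adj p' q'

/-- Triangle-free and fork-free on the vertex set `S`, phrased on vertices. -/
structure GoodOn (G : SimpleGraph V) (S : Set V) : Prop where
  tri : ∀ a ∈ S, ∀ b ∈ S, ∀ c ∈ S, G.Adj a b → G.Adj b c → G.Adj a c → False
  fork_free : ∀ v ∈ S, ∀ a ∈ S, ∀ b ∈ S, ∀ p ∈ S, ∀ p' ∈ S, ∀ q ∈ S, ∀ q' ∈ S,
    IsFork G v a b p p' q q' → False

theorem triangleFree_adj (h : G.CliqueFree 3) {a b c : V} (hab : G.Adj a b) (hbc : G.Adj b c)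
    (hac : G.Adj a c) : False := by
  classical
  exact h {a, b, c} (is3Clique_triple_iff.2 ⟨hab, hac, hbc⟩)

theorem fork_twins : ∀ i j : Fin 7, (∀ k, fork.Adj i k ↔ fork.Adj j k) →
    i = j ∨ (i = 1 ∧ j = 2) ∨ (i = 2 ∧ j = 1) := by
  simp only [fork, fromEdgeSet_adj, Set.mem_insert_iff, Set.mem_singleton_iff]
  decide

theorem isFork_false (h3 : G.CliqueFree 3) (hf : ForkFree G) {v a b p p' q q' : V}
    (h : IsFork G v a b p p' q q') : False := by
  obtain ⟨va, vb, vp, vq, pp, qq, ne, ap, bp, qp, aq, bq, pq, tt⟩ := h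
  have t : ∀ {a b c : V}, G.Adj a b → G.Adj b c → ¬ G.Adj a c :=
    fun h1 h2 h3' => triangleFree_adj h3 h1 h2 h3'
  have nab := t va.symm vb
  have nap := t va.symm vp
  have naq := t va.symm vq
  have nbp := t vb.symm vp
  have nbq := t vb.symm vq
  have npq := t vp.symm vq
  have nvp := t vp pp
  have nvq := t vq qq
  have key : ∀ i j : Fin 7, fork.Adj i j ↔
      G.Adj (![v, a, b, p, p', q, q'] i) (![v, a, b, p, p', q, q'] j) := by
    intro i j
    fin_cases i <;> fin_cases j <;> simp [fork] <;> grind [SimpleGraph.adj_comm]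
  have inj : Function.Injective ![v, a, b, p, p', q, q'] := by
    intro i j hij
    have hk : ∀ k, fork.Adj i k ↔ fork.Adj j k := fun k => by rw [key, key, hij]
    rcases fork_twins i j hk with h | ⟨rfl, rfl⟩ | ⟨rfl, rfl⟩
    · exact h
    · exact (ne hij).elim
    · exact (ne hij.symm).elim
  exact hf.false ⟨⟨_, inj⟩, fun {i j} => (key i j).symm⟩

theorem goodOn_univ (h3 : G.CliqueFree 3) (hf : ForkFree G) : GoodOn G Set.univ :=
  ⟨fun _ _ _ _ _ _ => triangleFree_adj h3,
    fun _ _ _ _ _ _ _ _ _ _ _ _ _ _ => isFork_false h3 hf⟩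

theorem GoodOn.mono {S T : Set V} (h : GoodOn G T) (hST : S ⊆ T) : GoodOn G S :=
  ⟨fun a ha b hb c hc => h.tri a (hST ha) b (hST hb) c (hST hc),
    fun v hv a ha b hb p hp p' hp' q hq q' hq' =>
      h.fork_free v (hST hv) a (hST ha) b (hST hb) p (hST hp) p' (hST hp') q (hST hq) q' (hST hq')⟩

theorem GoodOn.cliqueFree_induce {S : Set V} (h : GoodOn G S) : (G.induce S).CliqueFree 3 := by
  classical
  intro s hs
  obtain ⟨a, b, c, hab, hac, hbc, -⟩ := is3Clique_iff.1 hs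
  exact h.tri a a.2 b b.2 c c.2 hab hbc hac

theorem GoodOn.forkFree_induce {S : Set V} (h : GoodOn G S) : ForkFree (G.induce S) := by
  refine ⟨fun f => ?_⟩
  have e : ∀ i j, G.Adj (f i) (f j) ↔ fork.Adj i j := fun i j => f.map_adj_iff
  refine h.fork_free (f 0) (f 0).2 (f 1) (f 1).2 (f 2) (f 2).2 (f 3) (f 3).2 (f 4) (f 4).2
    (f 5) (f 5).2 (f 6) (f 6).2 ⟨?_, ?_, ?_, ?_, ?_, ?_, ?_, ?_, ?_, ?_, ?_, ?_, ?_, ?_⟩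
  case refine_7 =>
    intro hh
    exact absurd (f.injective (Subtype.ext hh)) (by decide)
  all_goals rw [e]; simp [fork]

/-- A minimal counterexample: every proper vertex subset carrying a triangle-free and fork-free
graph is 3-colourable, but `G` itself is not. -/
structure MinCex (G : SimpleGraph V) : Prop where
  good : GoodOn G Set.univ
  small : ∀ (H : SimpleGraph V) (S : Set V), S ≠ Set.univ → GoodOn H S →
    ∃ f : V → Fin 3, ∀ x ∈ S, ∀ y ∈ S, H.Adj x y → f x ≠ f y
  not_colorable : ¬ G.Colorable 3

theorem exists_minCex_or_colorable (n : ℕ) : ∀ {V : Type} [Fintype V] (G : SimpleGraph V),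
    Fintype.card V = n → GoodOn G Set.univ →
    (∀ {W : Type} [Fintype W] (H : SimpleGraph W), ¬ MinCex H) → G.Colorable 3 := by
  induction n using Nat.strong_induction_on with
  | _ n ih =>
    intro V _ G hn hG hno
    by_contra hc
    classical
    refine hno G ⟨hG, fun H S hS hHS => ?_, hc⟩
    have hcard : Fintype.card S < n := by
      rw [← hn]
      obtain ⟨x, hx⟩ := (Set.ne_univ_iff_exists_notMem S).1 hS
      exact Fintype.card_subtype_lt (x := x) hx
    obtain ⟨col⟩ := ih _ hcard (H.induce S) rfl
      (goodOn_univ hHS.cliqueFree_induce hHS.forkFree_induce) hno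
    refine ⟨fun v => if hv : v ∈ S then col ⟨v, hv⟩ else 0, fun x hx y hy hxy => ?_⟩
    simp only [hx, hy, dif_pos]
    exact col.valid (show (H.induce S).Adj ⟨x, hx⟩ ⟨y, hy⟩ from hxy)

theorem chromaticNumber_le_of_colorable_three [Fintype V] (h : G.Colorable 3) :
    G.chromaticNumber ≤ (G.cliqueNum : ℕ∞) + 1 := by
  classical
  by_cases he : ∃ a b, G.Adj a b
  · obtain ⟨a, b, hab⟩ := he
    have h2 : 2 ≤ G.cliqueNum := by
      have : G.IsClique ({a, b} : Finset V) := by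
        simp [isClique_iff, Set.Pairwise, hab, hab.symm]
      have := this.card_le_cliqueNum
      rwa [Finset.card_pair hab.ne] at this
    calc G.chromaticNumber ≤ (3 : ℕ) := h.chromaticNumber_le
      _ ≤ (G.cliqueNum : ℕ∞) + 1 := by
        have : 3 ≤ G.cliqueNum + 1 := by omega
        exact_mod_cast this
  · push Not at he
    have : G.Colorable 1 := ⟨Coloring.mk (fun _ => 0) (fun {v w} hvw => (he v w hvw).elim)⟩
    calc G.chromaticNumber ≤ (1 : ℕ) := this.chromaticNumber_le
      _ ≤ (G.cliqueNum : ℕ∞) + 1 := by simp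

end SimpleGraph

namespace SimpleGraph

variable {V : Type} {G : SimpleGraph V}

theorem MinCex.tri (h : MinCex G) {a b c : V} (hab : G.Adj a b) (hbc : G.Adj b c) :
    ¬ G.Adj a c :=
  h.good.tri a trivial b trivial c trivial hab hbc

theorem MinCex.fork_false (h : MinCex G) {v a b p p' q q' : V}
    (hf : IsFork G v a b p p' q q') : False :=
  h.good.fork_free v trivial a trivial b trivial p trivial p' trivial q trivial q' trivial hf

/-- In a minimal counterexample no neighbourhood is contained in another one. -/
theorem MinCex.exists_adj_not_adj (h : MinCex G) {u v : V} (huv : u ≠ v) :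
    ∃ t, G.Adj u t ∧ ¬ G.Adj v t := by
  classical
  by_contra hc
  push Not at hc
  obtain ⟨f, hf⟩ := h.small G {u}ᶜ (by simp) (h.good.mono (Set.subset_univ _))
  have hf' : ∀ x y, x ≠ u → y ≠ u → G.Adj x y → f x ≠ f y := fun x y hx hy => hf x hx y hy
  refine h.not_colorable ⟨Coloring.mk (fun x => if x = u then f v else f x) ?_⟩
  intro x y hxy
  by_cases hx : x = u
  · subst hx
    have hy : y ≠ x := hxy.ne'
    simp only [if_pos, if_neg hy]
    exact hf' v y huv.symm hy (hc y hxy)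
  · by_cases hy : y = u
    · subst hy
      simp only [if_pos, if_neg hx]
      exact (hf' v x huv.symm hx (hc x hxy.symm)).symm
    · simp only [if_neg hx, if_neg hy]
      exact hf' x y hx hy hxy

/-- A maximum independent set. -/
structure MaxInd (G : SimpleGraph V) (I : Finset V) : Prop where
  ind : ∀ x ∈ I, ∀ y ∈ I, ¬ G.Adj x y
  max : ∀ J : Finset V, (∀ x ∈ J, ∀ y ∈ J, ¬ G.Adj x y) → J.card ≤ I.card

theorem exists_maxInd [Fintype V] (G : SimpleGraph V) : ∃ I, MaxInd G I := by
  classical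
  obtain ⟨I, hI, hmax⟩ := Finset.exists_max_image
    (Finset.univ.filter fun J : Finset V => ∀ x ∈ J, ∀ y ∈ J, ¬ G.Adj x y) Finset.card
    ⟨∅, by simp⟩
  exact ⟨I, (Finset.mem_filter.1 hI).2,
    fun J hJ => hmax J (Finset.mem_filter.2 ⟨Finset.mem_univ _, hJ⟩)⟩

theorem MaxInd.card_le {I : Finset V} (hI : MaxInd G I) (X T : Finset V)
    (hX : ∀ x ∈ X, ∀ y ∈ X, ¬ G.Adj x y) (hXI : ∀ x ∈ X, x ∉ I)
    (hT : ∀ x ∈ X, ∀ z ∈ I, G.Adj x z → z ∈ T) : X.card ≤ T.card := by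
  classical
  have h1 := hI.max ((I \ T) ∪ X) (by
    have := hI.ind
    intro x hx y hy hxy
    simp only [Finset.mem_union, Finset.mem_sdiff] at hx hy
    rcases hx with hx | hx <;> rcases hy with hy | hy
    · exact hI.ind x hx.1 y hy.1 hxy
    · exact hx.2 (hT y hy x hx.1 hxy.symm)
    · exact hy.2 (hT x hx y hy.1 hxy)
    · exact hX x hx y hy hxy)
  rw [Finset.card_union_of_disjoint] at h1
  · have := Finset.le_card_sdiff T I
    omega
  · rw [Finset.disjoint_left]
    intro x hx hx'
    exact hXI x hx' (Finset.mem_sdiff.1 hx).1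

theorem MaxInd.exists_adj {I : Finset V} (hI : MaxInd G I) {x : V} (hx : x ∉ I) :
    ∃ z ∈ I, G.Adj x z := by
  by_contra hc
  push Not at hc
  have := hI.card_le {x} ∅ (by simp) (by simpa using hx) (by simpa using hc)
  simp at this

/-- A closed walk of length `m` outside `I`, as an `m`-periodic sequence. -/
structure ClosedWalk (G : SimpleGraph V) (I : Finset V) (m : ℤ) (c : ℤ → V) : Prop where
  per : ∀ i, c (i + m) = c i
  adj : ∀ i, G.Adj (c i) (c (i + 1))
  notMem : ∀ i, c i ∉ I

theorem ClosedWalk.of_segment {I : Finset V} {m : ℤ} {f : ℤ → V} (hm : 1 ≤ m)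
    (adj : ∀ i, 0 ≤ i → i < m - 1 → G.Adj (f i) (f (i + 1)))
    (close : G.Adj (f (m - 1)) (f 0)) (notMem : ∀ i, 0 ≤ i → i < m → f i ∉ I) :
    ClosedWalk G I m (fun i => f (i % m)) := by
  refine ⟨fun i => by simp, fun i => ?_, fun i => ?_⟩
  · have h0 := Int.emod_nonneg i (show m ≠ 0 by omega)
    have h1 := Int.emod_lt_of_pos i (show 0 < m by omega)
    by_cases h : i % m < m - 1
    · have : (i + 1) % m = i % m + 1 := by
        rw [← Int.emod_add_emod, Int.emod_eq_of_lt (by omega) (by omega)]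
      simp only [this]
      exact adj _ h0 h
    · have e : i % m = m - 1 := by omega
      have : (i + 1) % m = 0 := by
        rw [← Int.emod_add_emod, e]; simp
      simp only [this, e]
      exact close
  · exact notMem _ (Int.emod_nonneg i (by omega)) (Int.emod_lt_of_pos i (by omega))

theorem MinCex.exists_closedWalk (h : MinCex G) (I : Finset V) (hI : MaxInd G I) :
    ∃ (m : ℕ) (c : ℤ → V), Odd m ∧ ClosedWalk G I m c := by
  classical
  by_contra hc
  have h2 : (G.induce {x | x ∉ I}).Colorable 2 := by
    rw [two_colorable_iff_forall_loop_even]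
    intro u w
    by_contra hodd
    rw [Nat.not_even_iff_odd] at hodd
    refine hc ⟨w.length, _, hodd, ClosedWalk.of_segment
      (f := fun i => (w.getVert i.toNat : V)) ?_ ?_ ?_ ?_⟩
    · have := hodd.pos; omega
    · intro i h0 h1
      have := w.adj_getVert_succ (i := i.toNat) (by omega)
      have e : (i + 1).toNat = i.toNat + 1 := by omega
      simp only [e]
      exact this
    · have := w.adj_getVert_succ (i := w.length - 1) (by have := hodd.pos; omega)
      have e : w.length - 1 + 1 = w.length := by have := hodd.pos; omega
      rw [e, w.getVert_length] at this
      have e2 : ((w.length : ℤ) - 1).toNat = w.length - 1 := by omega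
      simp only [e2, Int.toNat_zero, w.getVert_zero]
      exact this
    · intro i _ _
      exact (w.getVert i.toNat).2
  obtain ⟨col⟩ := h2
  refine h.not_colorable ⟨Coloring.mk
    (fun x => if hx : x ∉ I then (col ⟨x, hx⟩).castSucc else Fin.last 2) ?_⟩
  intro x y hxy
  by_cases hx : x ∈ I <;> by_cases hy : y ∈ I
  · exact (hI.ind x hx y hy hxy).elim
  · simp only [hx, hy, not_true, not_false_eq_true, dif_pos, dif_neg]
    exact (Fin.castSucc_lt_last _).ne'
  · simp only [hx, hy, not_true, not_false_eq_true, dif_pos, dif_neg]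
    exact (Fin.castSucc_lt_last _).ne
  · simp only [hx, hy, not_false_eq_true, dif_pos]
    have := col.valid (show (G.induce {x | x ∉ I}).Adj ⟨x, hx⟩ ⟨y, hy⟩ from hxy)
    exact fun e => this (Fin.castSucc_injective _ e)

/-- An odd hole avoiding a maximum independent set, of minimum length among all odd closed
walks avoiding some maximum independent set. -/
structure OddHole (G : SimpleGraph V) (I : Finset V) (L : ℤ) (c : ℤ → V) : Prop where
  cex : MinCex G
  maxInd : MaxInd G I
  odd : Odd L
  five : 5 ≤ L
  per : ∀ i, c (i + L) = c i
  adj : ∀ i, G.Adj (c i) (c (i + 1))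
  nadj : ∀ i j, i + 2 ≤ j → j + 2 ≤ i + L → ¬ G.Adj (c i) (c j)
  ne : ∀ i j, i < j → j < i + L → c i ≠ c j
  notMem : ∀ i, c i ∉ I
  swap : ∀ i z, z ∈ I → G.Adj (c i) z → (∀ y ∈ I, G.Adj (c i) y → y = z) →
    G.Adj (c (i + 2)) z → ¬ G.Adj (c (i - 2)) z

theorem MinCex.exists_oddHole [Fintype V] (h : MinCex G) :
    ∃ (I : Finset V) (L : ℤ) (c : ℤ → V), OddHole G I L c := by
  classical
  let P : ℕ → Prop := fun m => Odd m ∧ ∃ I c, MaxInd G I ∧ ClosedWalk G I m c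
  have hP : ∃ m, P m := by
    obtain ⟨I, hI⟩ := exists_maxInd G
    obtain ⟨m, c, hm, hc⟩ := h.exists_closedWalk I hI
    exact ⟨m, hm, I, c, hI, hc⟩
  obtain ⟨hodd, I, c, hI, hw⟩ := Nat.find_spec hP
  have hmin : ∀ (m : ℤ) (J : Finset V) (f : ℤ → V), Odd m → 1 ≤ m → m < Nat.find hP →
      MaxInd G J → ¬ ClosedWalk G J m f := by
    intro m J f hm h1 hlt hJ hf
    lift m to ℕ using by omega
    exact Nat.find_min hP (by omega) ⟨by exact_mod_cast hm, J, f, hJ, hf⟩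
  have hoddZ : Odd ((Nat.find hP : ℕ) : ℤ) := by exact_mod_cast hodd
  have hpos : 0 ≤ ((Nat.find hP : ℕ) : ℤ) := by positivity
  generalize ((Nat.find hP : ℕ) : ℤ) = L at *
  obtain ⟨per, adj, notMem⟩ := hw
  have five : 5 ≤ L := by
    by_contra hlt
    have : L = 1 ∨ L = 3 := by obtain ⟨k, hk⟩ := hoddZ; omega
    rcases this with rfl | rfl
    · exact (adj 0).ne (per 0).symm
    · have h1 := adj 2
      have h2 := per 0
      norm_num at h1 h2
      rw [h2] at h1
      exact h.tri (adj 0) (adj 1) h1.symm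
  have even_chord : ∀ i j, Even (j - i) → i + 2 ≤ j → j + 2 ≤ i + L → ¬ G.Adj (c i) (c j) := by
    intro i j he h1 h2 hij
    refine hmin (j - i + 1) I _ he.add_one (by omega) (by omega) hI
      (ClosedWalk.of_segment (f := fun k => c (i + k)) (by omega) ?_ ?_ fun k _ _ => notMem _)
    · intro k _ _
      have := adj (i + k)
      rwa [add_assoc] at this
    · simp only [add_zero]
      have e : i + (j - i + 1 - 1) = j := by ring
      rw [e]
      exact hij.symm
  have nadj : ∀ i j, i + 2 ≤ j → j + 2 ≤ i + L → ¬ G.Adj (c i) (c j) := by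
    intro i j h1 h2 hij
    by_cases he : Even (j - i)
    · exact even_chord i j he h1 h2 hij
    · refine even_chord j (i + L) ?_ h2 (by omega) (by rw [per]; exact hij.symm)
      rw [Int.not_even_iff_odd] at he
      have : i + L - j = L - (j - i) := by ring
      rw [this]
      exact hoddZ.sub_odd he
  have ne : ∀ i j, i < j → j < i + L → c i ≠ c j := by
    intro i j h1 h2 hij
    have a1 := adj (i - 1)
    have a2 := adj i
    rw [sub_add_cancel] at a1
    rw [hij] at a1 a2
    by_cases h3 : j + 3 ≤ i + L
    · exact nadj (i - 1) j (by omega) (by omega) a1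
    · by_cases h4 : j + 2 = i + L
      · exact nadj (i + 1) j (by omega) (by omega) a2.symm
      · have e : j + 1 = i + L := by omega
        have := adj j
        rw [e, per, hij] at this
        exact this.ne rfl
  refine ⟨I, L, c, h, hI, hoddZ, five, per, adj, nadj, ne, notMem, ?_⟩
  intro i z hz hiz huniq h2 h3
  have hI' : MaxInd G (insert (c i) (I.erase z)) := by
    refine ⟨?_, fun J hJ => ?_⟩
    · have := hI.ind
      intro x hx y hy hxy
      have hxx := hxy.ne
      simp only [Finset.mem_insert, Finset.mem_erase] at hx hy
      rcases hx with rfl | hx <;> rcases hy with rfl | hy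
      · exact hxx rfl
      · exact hy.1 (huniq y hy.2 hxy)
      · exact hx.1 (huniq x hx.2 hxy.symm)
      · exact this x hx.2 y hy.2 hxy
    · rw [Finset.card_insert_of_notMem (by simp [notMem]), Finset.card_erase_add_one hz]
      exact hI.max J hJ
  have hzc : ∀ j, c j ≠ z := fun j e => notMem j (e ▸ hz)
  refine hmin (L - 2) _ _ (hoddZ.sub_even (by decide)) (by omega) (by omega) hI'
    (ClosedWalk.of_segment (f := fun k => if k = 0 then z else c (i + 1 + k)) (by omega) ?_ ?_ ?_)
  · intro k hk0 hk1
    simp only [show k + 1 ≠ 0 by omega, if_false]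
    by_cases hk : k = 0
    · subst hk
      simp only [if_true]
      convert h2.symm using 2
      ring
    · simp only [hk, if_false]
      rw [← add_assoc]
      exact adj (i + 1 + k)
  · simp only [show L - 2 - 1 ≠ 0 by omega, if_false, if_true]
    convert h3 using 1
    rw [← per (i - 2)]
    congr 1
    ring
  · intro k hk0 hk1
    by_cases hk : k = 0
    · simp [hk, (hzc i).symm]
    · simp only [hk, if_false, Finset.mem_insert, Finset.mem_erase, not_or]
      exact ⟨(ne i _ (by omega) (by omega)).symm, fun h => notMem _ h.2⟩

end SimpleGraph

namespace SimpleGraph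

variable {V : Type} {G : SimpleGraph V} {I : Finset V} {L : ℤ} {c : ℤ → V}

/-- The neighbours of `c i` in `I`. -/
def trace (G : SimpleGraph V) (I : Finset V) (c : ℤ → V) (i : ℤ) : Set V :=
  {z | z ∈ I ∧ G.Adj (c i) z}

namespace OddHole

theorem shift (H : OddHole G I L c) (k : ℤ) : OddHole G I L (fun i => c (i + k)) where
  cex := H.cex
  maxInd := H.maxInd
  odd := H.odd
  five := H.five
  per i := by rw [add_right_comm, H.per]
  adj i := by rw [add_right_comm]; exact H.adj _
  nadj i j h1 h2 := H.nadj _ _ (by omega) (by omega)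
  ne i j h1 h2 := H.ne _ _ (by omega) (by omega)
  notMem i := H.notMem _
  swap i z hz h1 h2 h3 h4 :=
    H.swap (i + k) z hz h1 h2 (by rwa [add_right_comm]) (by rwa [sub_add_eq_add_sub] at h4)

theorem adj_sub_one (H : OddHole G I L c) (i : ℤ) : G.Adj (c i) (c (i - 1)) := by
  simpa using (H.adj (i - 1)).symm

theorem reflect (H : OddHole G I L c) : OddHole G I L (fun i => c (-i)) where
  cex := H.cex
  maxInd := H.maxInd
  odd := H.odd
  five := H.five
  per i := by
    rw [← H.per (-(i + L))]
    congr 1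
    ring
  adj i := by
    rw [neg_add']
    exact H.adj_sub_one _
  nadj i j h1 h2 h := H.nadj (-j) (-i) (by omega) (by omega) h.symm
  ne i j h1 h2 := (H.ne (-j) (-i) (by omega) (by omega)).symm
  notMem i := H.notMem _
  swap i z hz h1 h2 h3 h4 := by
    refine H.swap (-i) z hz h1 h2 ?_ ?_
    · convert h4 using 2; ring
    · convert h3 using 2; ring

theorem per_mul (H : OddHole G I L c) (i k : ℤ) : c (i + k * L) = c i := by
  induction k using Int.induction_on with
  | zero => simp
  | succ k ih => rw [add_one_mul, ← add_assoc, H.per, ih]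
  | pred k ih => rw [← H.per, ← ih]; congr 1; ring

theorem eq_iff (H : OddHole G I L c) {i j : ℤ} : c i = c j ↔ ∃ k, j = i + k * L := by
  refine ⟨fun h => ?_, fun ⟨k, hk⟩ => by rw [hk, H.per_mul]⟩
  have h5 := H.five
  refine ⟨(j - i) / L, ?_⟩
  by_contra hne
  have e := Int.emod_add_mul_ediv (j - i) L
  have h0 := Int.emod_nonneg (j - i) (show L ≠ 0 by omega)
  have h1 := Int.emod_lt_of_pos (j - i) (show 0 < L by omega)
  have h2 : (j - i) % L ≠ 0 := fun h' => hne (by rw [h'] at e; linarith)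
  refine H.ne i (i + (j - i) % L) (by omega) (by omega) ?_
  rw [h, ← H.per_mul (i + (j - i) % L) ((j - i) / L)]
  congr 1
  linarith

theorem eq_add (H : OddHole G I L c) {i j : ℤ} (h : c i = c j) (m : ℤ) :
    c (i + m) = c (j + m) := by
  obtain ⟨k, rfl⟩ := H.eq_iff.1 h
  exact H.eq_iff.2 ⟨k, by ring⟩

theorem eq_or_eq_of_adj (H : OddHole G I L c) {i j : ℤ} (h : G.Adj (c i) (c j)) :
    c j = c (i + 1) ∨ c j = c (i - 1) := by
  have h5 := H.five
  have e := Int.emod_add_mul_ediv (j - i) L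
  have h0 := Int.emod_nonneg (j - i) (show L ≠ 0 by omega)
  have h1 := Int.emod_lt_of_pos (j - i) (show 0 < L by omega)
  have hj : c j = c (i + (j - i) % L) := by
    rw [← H.per_mul (i + (j - i) % L) ((j - i) / L)]
    congr 1
    linarith
  rw [hj] at h ⊢
  generalize (j - i) % L = r at *
  by_cases r0 : r = 0
  · subst r0
    simp at h
  by_cases r1 : r = 1
  · subst r1; exact Or.inl rfl
  by_cases r2 : r = L - 1
  · right
    rw [← H.per (i - 1), r2]
    congr 1
    ring
  · exact (H.nadj i (i + r) (by omega) (by omega) h).elim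

theorem trace_shift (k i : ℤ) : trace G I (fun i => c (i + k)) i = trace G I c (i + k) := rfl

theorem trace_per (H : OddHole G I L c) (i : ℤ) : trace G I c (i + L) = trace G I c i := by
  simp only [trace, H.per]

theorem trace_nonempty (H : OddHole G I L c) (i : ℤ) : (trace G I c i).Nonempty := by
  obtain ⟨z, hz, h⟩ := H.maxInd.exists_adj (H.notMem i)
  exact ⟨z, hz, h⟩

theorem disjoint_trace (H : OddHole G I L c) {i j : ℤ} (h : G.Adj (c i) (c j)) {z : V}
    (hi : z ∈ trace G I c i) (hj : z ∈ trace G I c j) : False :=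
  H.cex.tri h hj.2 hi.2

theorem not_adj (H : OddHole G I L c) {x y : V} {i j : ℤ} (hx : x ∈ trace G I c i)
    (hy : y ∈ trace G I c j) : ¬ G.Adj x y :=
  H.maxInd.ind x hx.1 y hy.1

theorem not_adj_of_notMem {x : V} {i j : ℤ} (hx : x ∈ trace G I c i) (hy : x ∉ trace G I c j) :
    ¬ G.Adj (c j) x :=
  fun h => hy ⟨hx.1, h⟩

/-- If `c i` has two neighbours in `I`, then the traces of its neighbours are comparable. -/
theorem trace_comparable (H : OddHole G I L c) {i : ℤ} {w z : V} (hw : w ∈ trace G I c i)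
    (hz : z ∈ trace G I c i) (hne : w ≠ z) :
    trace G I c (i - 1) ⊆ trace G I c (i + 1) ∨ trace G I c (i + 1) ⊆ trace G I c (i - 1) := by
  by_contra hc
  rw [not_or, Set.not_subset, Set.not_subset] at hc
  obtain ⟨⟨p, hp, hp'⟩, q, hq, hq'⟩ := hc
  exact H.cex.fork_false ⟨hw.2, hz.2, H.adj_sub_one i, H.adj i, hp.2, hq.2, hne,
    H.not_adj hw hp, H.not_adj hz hp, not_adj_of_notMem hp hp', H.not_adj hw hq,
    H.not_adj hz hq, not_adj_of_notMem hq hq', H.not_adj hp hq⟩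

theorem fork_two_back (H : OddHole G I L c) {i : ℤ} {a b w : V} (ha : a ∈ trace G I c i)
    (hb : b ∈ trace G I c i) (hne : a ≠ b) (ha' : a ∉ trace G I c (i - 2))
    (hb' : b ∉ trace G I c (i - 2)) (hw : w ∈ trace G I c (i + 1))
    (hw1 : w ∉ trace G I c (i - 1)) (hw2 : w ∉ trace G I c (i - 2)) : False := by
  have h5 := H.five
  have e : G.Adj (c (i - 1)) (c (i - 2)) := by
    have := H.adj_sub_one (i - 1)
    rwa [sub_sub] at this
  exact H.cex.fork_false ⟨ha.2, hb.2, H.adj_sub_one i, H.adj i, e, hw.2, hne,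
    fun h => not_adj_of_notMem ha ha' h.symm, fun h => not_adj_of_notMem hb hb' h.symm,
    fun h => H.nadj (i - 2) (i + 1) (by omega) (by omega) h.symm, H.not_adj ha hw,
    H.not_adj hb hw, not_adj_of_notMem hw hw1, not_adj_of_notMem hw hw2⟩

theorem mem_trace_of_mem_diff (H : OddHole G I L c) {i j : ℤ} {w z x : V}
    (hw : w ∈ trace G I c i) (hz : z ∈ trace G I c i) (hwj : w ∈ trace G I c j)
    (hzj : z ∉ trace G I c j) (hp : ¬ G.Adj (c (i - 1)) (c j)) (hq : ¬ G.Adj (c (i + 1)) (c j))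
    (hx : (x ∈ trace G I c (i + 1) ∧ x ∉ trace G I c (i - 1)) ∨
      (x ∈ trace G I c (i - 1) ∧ x ∉ trace G I c (i + 1))) : x ∈ trace G I c j := by
  by_contra hxj
  have zj : ¬ G.Adj z (c j) := fun h => not_adj_of_notMem hz hzj h.symm
  have ne : ∀ k, z ≠ c k := fun k e => H.notMem k (e ▸ hz.1)
  rcases hx with ⟨h1, h2⟩ | ⟨h1, h2⟩
  · exact H.cex.fork_false ⟨hz.2, H.adj_sub_one i, hw.2, H.adj i, hwj.2.symm, h1.2, ne _, zj, hp,
      hq, H.not_adj hz h1, not_adj_of_notMem h1 h2, H.not_adj hw h1, not_adj_of_notMem h1 hxj⟩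
  · exact H.cex.fork_false ⟨hz.2, H.adj i, hw.2, H.adj_sub_one i, hwj.2.symm, h1.2, ne _, zj, hq,
      hp, H.not_adj hz h1, not_adj_of_notMem h1 h2, H.not_adj hw h1, not_adj_of_notMem h1 hxj⟩

theorem trace_eq_of_separated (H : OddHole G I L c) {i j : ℤ} {w z : V}
    (hw : w ∈ trace G I c i) (hz : z ∈ trace G I c i) (hwj : w ∈ trace G I c j)
    (hzj : z ∉ trace G I c j) (hp : ¬ G.Adj (c (i - 1)) (c j)) (hq : ¬ G.Adj (c (i + 1)) (c j))
    (hd : ∀ x ∈ trace G I c j, x ∉ trace G I c (i - 1) ∧ x ∉ trace G I c (i + 1)) :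
    trace G I c (i + 1) = trace G I c (i - 1) := by
  ext x
  have := H.mem_trace_of_mem_diff (x := x) hw hz hwj hzj hp hq
  have := hd x
  tauto

theorem fork_cross (H : OddHole G I L c) {i j k : ℤ} {w z : V}
    (hw : w ∈ trace G I c i) (hz : z ∈ trace G I c i) (hwj : w ∈ trace G I c j)
    (hzj : z ∉ trace G I c j) (hzk : z ∈ trace G I c k) (hwk : w ∉ trace G I c k)
    (hj1 : ¬ G.Adj (c (i - 1)) (c j)) (hj2 : ¬ G.Adj (c (i + 1)) (c j))
    (hk1 : ¬ G.Adj (c (i - 1)) (c k)) (hk2 : ¬ G.Adj (c (i + 1)) (c k))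
    (hjk : ¬ G.Adj (c j) (c k)) : False := by
  have h5 := H.five
  exact H.cex.fork_false ⟨H.adj_sub_one i, H.adj i, hw.2, hz.2, hwj.2.symm, hzk.2.symm,
    H.ne _ _ (by omega) (by omega), hj1, hj2, fun h => not_adj_of_notMem hz hzj h.symm, hk1, hk2,
    fun h => not_adj_of_notMem hw hwk h.symm, hjk⟩

theorem fork_two_ends (H : OddHole G I L c) {r s a b : ℤ} {z : V}
    (hr : z ∈ trace G I c r) (hr' : z ∉ trace G I c (r + 2))
    (hs : z ∈ trace G I c s) (hs' : z ∉ trace G I c (s + 2))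
    (ha : z ∈ trace G I c a) (hb : z ∈ trace G I c b)
    (hrs : c r ≠ c s) (hra : c r ≠ c a) (hrb : c r ≠ c b) (hsa : c s ≠ c a) (hsb : c s ≠ c b)
    (hab : c a ≠ c b) : False := by
  have key : ∀ {r s : ℤ}, z ∈ trace G I c r → z ∉ trace G I c (r + 2) → z ∈ trace G I c s →
      c r ≠ c s → ¬ G.Adj (c s) (c (r + 1)) := by
    intro r s hr hr' hs hrs h
    rcases H.eq_or_eq_of_adj h.symm with e | e
    · rw [add_assoc] at e
      exact hr' ⟨hs.1, e ▸ hs.2⟩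
    · rw [add_sub_cancel_right] at e
      exact hrs e.symm
  have tt : ¬ G.Adj (c (r + 1)) (c (s + 1)) := by
    intro h
    have nrs : ¬ G.Adj (c r) (c s) := fun h => H.disjoint_trace h hr hs
    rcases H.eq_or_eq_of_adj h with e | e
    · have := H.eq_add e (-1)
      simp only [add_neg_cancel_right] at this
      exact nrs (this ▸ H.adj r)
    · rw [add_sub_cancel_right] at e
      exact nrs (e ▸ (H.adj s).symm)
  exact H.cex.fork_false ⟨ha.2.symm, hb.2.symm, hr.2.symm, hs.2.symm, H.adj r, H.adj s, hab,
    key hr hr' ha hra, key hr hr' hb hrb, key hr hr' hs hrs, key hs hs' ha hsa,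
    key hs hs' hb hsb, key hs hs' hr hrs.symm, tt⟩

end OddHole

end SimpleGraph

namespace SimpleGraph

variable {V : Type} {G : SimpleGraph V} {I : Finset V} {L : ℤ} {c : ℤ → V}

/-- The properties of the traces of a hole of length `2 * h + 1`, listed in steps of two, when
every vertex of the hole has at least two neighbours in the independent set. -/
structure QSystem (h : ℤ) (M : ℤ → Set V) : Prop where
  per : ∀ a, M (a + (2 * h + 1)) = M a
  nonempty : ∀ a, (M a).Nonempty
  disj : ∀ {a : ℤ} (b : ℤ) {z : V}, z ∈ M a → (b = a + h ∨ b = a + h + 1) → z ∉ M b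
  comp : ∀ a, M a ⊆ M (a + 1) ∨ M (a + 1) ⊆ M a
  cross : ∀ (a j k : ℤ) {w z : V}, w ∈ M a → z ∈ M a → w ∈ M j → z ∉ M j → z ∈ M k → w ∉ M k →
    2 ≤ |j - a| → |j - a| ≤ 2 * h - 1 → 2 ≤ |k - a| → |k - a| ≤ 2 * h - 1 → |j - k| ≤ h - 1 →
    False
  sep : ∀ (a j : ℤ) {w z x : V}, w ∈ M a → z ∈ M a → w ∈ M j → z ∉ M j → 2 ≤ |j - a| →
    |j - a| ≤ 2 * h - 1 → (x ∈ M (a + h) ∧ x ∉ M (a + h + 1) ∨ x ∈ M (a + h + 1) ∧ x ∉ M (a + h)) →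
    x ∈ M j
  ends : ∀ (a b r s : ℤ) {z : V}, z ∈ M a → z ∈ M b → z ∈ M r → z ∉ M (r + 1) → z ∈ M s →
    z ∉ M (s + 1) → a < b → b < r → r < s → s < a + (2 * h + 1) → False

namespace OddHole

theorem even_inj (H : OddHole G I L c) {a b : ℤ} (h : c (2 * a) = c (2 * b))
    (hab : |a - b| < L) : a = b := by
  obtain ⟨k, hk⟩ := H.eq_iff.1 h
  obtain ⟨n, hn⟩ := H.odd
  have h5 := H.five
  have hev : Even (k * L) := ⟨b - a, by linarith⟩
  have hL : ¬ Even L := by rw [Int.not_even_iff_odd]; exact H.odd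
  rcases (Int.even_mul.1 hev).resolve_right hL with ⟨m, rfl⟩
  have e : b - a = m * L := by linarith
  rw [abs_lt] at hab
  have h1 : m < 1 := by nlinarith
  have h2 : -1 < m := by nlinarith
  have : m = 0 := by omega
  subst this
  linarith

theorem odd_eq (H : OddHole G I L c) {h : ℤ} (hL : L = 2 * h + 1) (a : ℤ) :
    c (2 * a - 1) = c (2 * (a + h)) ∧ c (2 * a + 1) = c (2 * (a + h + 1)) := by
  constructor
  · rw [← H.per]; congr 1; rw [hL]; ring
  · rw [← H.per]; congr 1; rw [hL]; ring

theorem not_adj_of_near (H : OddHole G I L c) {h a j : ℤ} (hL : L = 2 * h + 1)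
    (h1 : 2 ≤ |j - a|) (h2 : |j - a| ≤ 2 * h - 1) :
    ¬ G.Adj (c (2 * a - 1)) (c (2 * j)) ∧ ¬ G.Adj (c (2 * a + 1)) (c (2 * j)) := by
  rw [le_abs] at h1
  rw [abs_le] at h2
  have inj : ∀ b, c (2 * j) = c (2 * b) → |j - b| < L → j = b := fun b => H.even_inj
  constructor
  · intro hadj
    rcases H.eq_or_eq_of_adj hadj with e | e
    · have := inj a (by rw [e]; congr 1; ring) (by rw [abs_lt]; omega)
      omega
    · have := inj (a - 1) (by rw [e]; congr 1; ring) (by rw [abs_lt]; omega)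
      omega
  · intro hadj
    rcases H.eq_or_eq_of_adj hadj with e | e
    · have := inj (a + 1) (by rw [e]; congr 1; ring) (by rw [abs_lt]; omega)
      omega
    · have := inj a (by rw [e]; congr 1; ring) (by rw [abs_lt]; omega)
      omega

theorem qSystem (H : OddHole G I L c) {h : ℤ} (hL : L = 2 * h + 1)
    (hQ : ∀ i, ∃ w ∈ trace G I c i, ∃ z ∈ trace G I c i, w ≠ z) :
    QSystem h (fun a => trace G I c (2 * a)) := by
  have h5 := H.five
  have odd1 : ∀ a, trace G I c (2 * (a + h)) = trace G I c (2 * a - 1) := fun a => by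
    simp only [trace, (H.odd_eq hL a).1]
  have odd2 : ∀ a, trace G I c (2 * (a + h + 1)) = trace G I c (2 * a + 1) := fun a => by
    simp only [trace, (H.odd_eq hL a).2]
  refine ⟨fun a => ?_, fun a => H.trace_nonempty _, ?_, fun a => ?_, ?_, ?_, ?_⟩
  · have e : 2 * (a + (2 * h + 1)) = 2 * a + L + L := by rw [hL]; ring
    simp only [e, H.trace_per]
  · rintro a b z hz (rfl | rfl) hb
    · rw [odd1] at hb
      exact H.disjoint_trace (H.adj_sub_one _) hz hb
    · rw [odd2] at hb
      exact H.disjoint_trace (H.adj _) hz hb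
  · obtain ⟨w, hw, z, hz, hne⟩ := hQ (2 * a + 1)
    have := H.trace_comparable hw hz hne
    have e1 : 2 * a + 1 - 1 = 2 * a := by ring
    have e2 : 2 * a + 1 + 1 = 2 * (a + 1) := by ring
    rwa [e1, e2] at this
  · intro a j k w z hw hz hwj hzj hzk hwk h1 h2 h3 h4 h6
    obtain ⟨j1, j2⟩ := H.not_adj_of_near hL h1 h2
    obtain ⟨k1, k2⟩ := H.not_adj_of_near hL h3 h4
    refine H.fork_cross hw hz hwj hzj hzk hwk j1 j2 k1 k2 fun hadj => ?_
    rw [abs_le] at h6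
    rcases H.eq_or_eq_of_adj hadj with e | e
    · rw [(H.odd_eq hL j).2] at e
      have := H.even_inj e (by rw [abs_lt]; omega)
      omega
    · rw [(H.odd_eq hL j).1] at e
      have := H.even_inj e (by rw [abs_lt]; omega)
      omega
  · intro a j w z x hw hz hwj hzj h1 h2 hx
    obtain ⟨j1, j2⟩ := H.not_adj_of_near hL h1 h2
    simp only [odd1, odd2] at hx
    exact H.mem_trace_of_mem_diff hw hz hwj hzj j1 j2 hx.symm
  · intro a b r s z ha hb hr hr' hs hs' h1 h2 h3 h4
    have inj : ∀ x y, x < y → y < x + L → c (2 * x) ≠ c (2 * y) := by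
      intro x y hx hy e
      have := H.even_inj e (by rw [abs_lt]; omega)
      omega
    rw [mul_add] at hr' hs'
    exact H.fork_two_ends hr hr' hs hs' ha hb (inj _ _ (by omega) (by omega))
      (inj _ _ (by omega) (by omega)).symm (inj _ _ (by omega) (by omega)).symm
      (inj _ _ (by omega) (by omega)).symm (inj _ _ (by omega) (by omega)).symm
      (inj _ _ (by omega) (by omega))

end OddHole
end SimpleGraph

namespace SimpleGraph

variable {V : Type} {G : SimpleGraph V} {I : Finset V} {L : ℤ} {c : ℤ → V}

namespace QSystem

variable {h : ℤ} {M : ℤ → Set V}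

theorem per' (S : QSystem h M) {a b : ℤ} (hab : b = a + (2 * h + 1)) : M a = M b := by
  rw [hab, S.per]

theorem exists_end (M : ℤ → Set V) {z : V} {a b : ℤ} (hab : a ≤ b) (ha : z ∈ M a) (hb : z ∉ M b) :
    ∃ r, a ≤ r ∧ r < b ∧ z ∈ M r ∧ z ∉ M (r + 1) := by
  by_contra hc
  push Not at hc
  refine hb (Int.leInduction (motive := fun n _ => n ≤ b → z ∈ M n) (fun _ => ha) ?_ b hab le_rfl)
  intro n hn ih hle
  exact hc n hn (by omega) (ih (by omega))

/-- The last index `k` on the right at which a trace meets the minimal trace `M 0`, with a common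
element `z` and an element `w` of the next traces. -/
structure RightEnd (h : ℤ) (M : ℤ → Set V) (k : ℤ) (z w : V) : Prop where
  pos : 1 ≤ k
  le : k ≤ h - 2
  z0 : z ∈ M 0
  zk : z ∈ M k
  w0 : w ∈ M k
  w1 : w ∈ M (k + 1)
  w2 : w ∈ M (k + 2)
  last : ∀ y ∈ M 0, ∀ j, k < j → j ≤ h → y ∉ M j

theorem RightEnd.w_notMem {k : ℤ} {z w : V} (R : RightEnd h M k z w) : w ∉ M 0 :=
  fun hw => R.last w hw (k + 1) (by omega) (by have := R.le; omega) R.w1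

theorem exists_rightEnd (S : QSystem h M) (h2 : 2 ≤ h) (hr : M 0 ⊆ M 1) (hl : M 0 ⊆ M (-1)) :
    ∃ k z w, RightEnd h M k z w := by
  obtain ⟨k, ⟨hk1, hkh, z, hz0, hzk⟩, hmax⟩ := Int.exists_greatest_of_bdd
    (P := fun k => 1 ≤ k ∧ k ≤ h ∧ ∃ z, z ∈ M 0 ∧ z ∈ M k) ⟨h, fun k hk => hk.2.1⟩
    (by obtain ⟨z, hz⟩ := S.nonempty 0; exact ⟨1, le_rfl, by omega, z, hz, hr hz⟩)
  have last : ∀ y ∈ M 0, ∀ j, k < j → j ≤ h → y ∉ M j := by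
    intro y hy j hj hjh hyj
    have := hmax j ⟨by omega, hjh, y, hy, hyj⟩
    omega
  have hk2 : k ≤ h - 2 := by
    by_contra hlt
    exact S.disj k (hl hz0) (by omega) hzk
  have sub : M (k + 1) ⊆ M k :=
    (S.comp k).resolve_left fun hs => last z hz0 (k + 1) (by omega) (by omega) (hs hzk)
  have e : k + 1 + 1 = k + 2 := by ring
  rcases S.comp (k + 1) with hs | hs
  · rw [e] at hs
    obtain ⟨w, hw⟩ := S.nonempty (k + 1)
    exact ⟨k, z, w, hk1, hk2, hz0, hzk, sub hw, hw, hs hw, last⟩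
  · rw [e] at hs
    obtain ⟨w, hw⟩ := S.nonempty (k + 2)
    exact ⟨k, z, w, hk1, hk2, hz0, hzk, sub (hs hw), hs hw, hw, last⟩

theorem RightEnd.eq_of_five_le (S : QSystem h M) (h5 : 5 ≤ h) (hl : M 0 ⊆ M (-1)) {k : ℤ} {z w : V}
    (R : RightEnd h M k z w) : k = h - 2 := by
  have hw := R.w_notMem
  obtain ⟨pos, le, z0, zk, w0, w1, w2, last⟩ := R
  by_contra hne
  have zk2 := last z z0 (k + 2) (by omega) (by omega)
  by_cases hk : k = 1
  · subst hk
    by_cases hwm : w ∈ M (-1)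
    · have hb : w ∉ M (1 + h) := S.disj _ w0 (by omega)
      obtain ⟨r, h1, h2, h3, h4⟩ := exists_end M (by omega) w2 hb
      refine S.ends 1 2 r (2 * h) w0 w1 h3 h4 ?_ ?_ (by omega) (by omega) (by omega) (by omega)
      · rwa [← S.per' (a := -1) (b := 2 * h) (by ring)]
      · rwa [← S.per' (a := 0) (b := 2 * h + 1) (by ring)]
    · exact S.cross 1 3 (-1) w0 zk w2 zk2 (hl z0) hwm (by norm_num) (by norm_num; omega)
        (by norm_num) (by norm_num; omega) (by norm_num; omega)
  · refine S.cross k (k + 2) 0 w0 zk w2 zk2 z0 hw ?_ ?_ ?_ ?_ ?_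
    · norm_num
    · norm_num; omega
    · rw [le_abs]; omega
    · rw [abs_le]; omega
    · rw [abs_le]; omega

theorem RightEnd.mem_two (S : QSystem h M) (h5 : 5 ≤ h) (hr : M 0 ⊆ M 1) (hl : M 0 ⊆ M (-1))
    {k : ℤ} {z w : V} (R : RightEnd h M k z w) : z ∈ M 2 ∧ z ∉ M (-2) := by
  have hk := R.eq_of_five_le S h5 hl
  obtain ⟨pos, le, z0, zk, w0, w1, w2, last⟩ := R
  refine ⟨?_, fun hz => S.disj k hz (by omega) zk⟩
  by_contra hz2
  exact S.ends (-1) 0 1 k (hl z0) z0 (hr z0) hz2 zk (last z z0 (k + 1) (by omega) (by omega))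
    (by omega) (by omega) (by omega) (by omega)

theorem sep_eq (S : QSystem h M) (a j k : ℤ) {w z : V} (hw : w ∈ M a) (hz : z ∈ M a)
    (hwj : w ∈ M j) (hzj : z ∉ M j) (hzk : z ∈ M k) (hwk : w ∉ M k)
    (hj1 : 2 ≤ |j - a|) (hj2 : |j - a| ≤ 2 * h - 1) (hk1 : 2 ≤ |k - a|) (hk2 : |k - a| ≤ 2 * h - 1)
    (hjk : ∀ x ∈ M j, x ∉ M k) : M (a + h) = M (a + h + 1) := by
  ext x
  have h1 := S.sep a j (x := x) hw hz hwj hzj hj1 hj2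
  have h2 := S.sep a k (x := x) hz hw hzk hwk hk1 hk2
  have := hjk x
  tauto

theorem four_z (S : QSystem 4 M) (hr : M 0 ⊆ M 1) (hl : M 0 ⊆ M (-1)) {z : V} (hz : z ∈ M 0) :
    z ∉ M 3 ∧ z ∉ M 4 ∧ z ∉ M 5 ∧ z ∉ M 6 :=
  ⟨S.disj 3 (hl hz) (by norm_num), S.disj 4 hz (by norm_num), S.disj 5 hz (by norm_num),
    S.disj 6 (hr hz) (by norm_num)⟩

theorem four_one (S : QSystem 4 M) (hr : M 0 ⊆ M 1) (hl : M 0 ⊆ M (-1)) {z w : V}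
    (R : RightEnd 4 M 1 z w) :
    M 5 = M 6 := by
  obtain ⟨pos, le, z0, zk, w0, w1, w2, last⟩ := R
  refine S.sep_eq 1 3 (-1) w0 zk w2 (S.four_z hr hl z0).1 (hl z0) (fun hm => ?_)
    (by norm_num) (by norm_num) (by norm_num) (by norm_num) (fun x hx hx' => ?_)
  · exact S.disj 3 hm (by norm_num) w2
  · exact S.disj 3 hx' (by norm_num) hx

theorem four_two (S : QSystem 4 M) (hr : M 0 ⊆ M 1) (hl : M 0 ⊆ M (-1)) {z w : V}
    (R : RightEnd 4 M 2 z w) :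
    w ∉ M 5 := by
  obtain ⟨pos, le, z0, zk, w0, w1, w2, last⟩ := R
  have e : M (-4) = M 5 := S.per' (by norm_num)
  intro h5
  rw [← e] at h5
  refine S.cross 2 (-4) (-1) w0 zk h5 ?_ (hl z0) (fun hm => ?_)
    (by norm_num) (by norm_num) (by norm_num) (by norm_num) (by norm_num)
  · rw [e]; exact (S.four_z hr hl z0).2.2.1
  · exact S.disj 3 hm (by norm_num) w1

theorem four_one_one (S : QSystem 4 M) (S' : QSystem 4 (fun a => M (-a))) (hr : M 0 ⊆ M 1)
    (hl : M 0 ⊆ M (-1)) {z w z' w' : V}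
    (R : RightEnd 4 M 1 z w) (R' : RightEnd 4 (fun a => M (-a)) 1 z' w') : False := by
  have e1 := S.four_one hr hl R
  have e2 := S'.four_one (by simpa using hl) (by simpa using hr) R'
  obtain ⟨pos, le, z0, zk, w0, w1, w2, last⟩ := R
  obtain ⟨pos', le', z0', zk', w0', w1', w2', last'⟩ := R'
  norm_num at *
  have p3 : M (-6) = M 3 := S.per' (by norm_num)
  have p4 : M (-5) = M 4 := S.per' (by norm_num)
  have p6 : M (-3) = M 6 := S.per' (by norm_num)
  have p5 : M (-4) = M 5 := S.per' (by norm_num)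
  rw [p3, p4] at e2
  rw [p6, ← e1] at w2'
  rw [← e2] at w2
  rcases S.comp 4 with hs | hs
  · exact S.disj 5 w0 (by norm_num) (hs w2)
  · exact S.disj 4 w0' (by norm_num) (hs w2')

theorem four_two_two (S : QSystem 4 M) (hr : M 0 ⊆ M 1) (hl : M 0 ⊆ M (-1)) {z w z' w' : V}
    (R : RightEnd 4 M 2 z w) (R' : RightEnd 4 (fun a => M (-a)) 2 z' w') : False := by
  have w5 := S.four_two hr hl R
  obtain ⟨pos, le, z0, zk, w0, w1, w2, last⟩ := R
  obtain ⟨pos', le', z0', zk', w0', w1', w2', last'⟩ := R'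
  norm_num at *
  have := S.sep_eq 0 2 (-2) z0 z0' zk (fun hm => S.disj 2 zk' (by norm_num) hm) zk'
    (fun hm => S.disj 2 hm (by norm_num) zk)
    (by norm_num) (by norm_num) (by norm_num) (by norm_num)
    (fun x hx hx' => S.disj 2 hx' (by norm_num) hx)
  norm_num at this
  exact w5 (this ▸ w2)

theorem four_two_one (S : QSystem 4 M) (hr : M 0 ⊆ M 1) (hl : M 0 ⊆ M (-1)) {z w z' w' : V}
    (R : RightEnd 4 M 2 z w) (R' : RightEnd 4 (fun a => M (-a)) 1 z' w') : False := by
  have w5 := S.four_two hr hl R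
  obtain ⟨pos, le, z0, zk, w0, w1, w2, last⟩ := R
  obtain ⟨pos', le', z0', zk', w0', w1', w2', last'⟩ := R'
  norm_num at *
  obtain ⟨z3, z4, z5, z6⟩ := S.four_z hr hl z0
  have p6 : M (-3) = M 6 := S.per' (by norm_num)
  have w'2 : w' ∉ M 2 := S.disj 2 w1' (by norm_num)
  have w'5 : w' ∉ M 5 := fun h5 => S.cross (-1) 5 2 w0' (hl z0) h5 z5 zk w'2
    (by norm_num) (by norm_num) (by norm_num) (by norm_num) (by norm_num)
  have e1 := S.sep_eq (-1) 2 (-3) (hl z0) w0' zk w'2 w2' (p6 ▸ z6)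
    (by norm_num) (by norm_num) (by norm_num) (by norm_num)
    (fun x hx hx' => S.disj 2 hx' (by norm_num) hx)
  have e2 := S.sep_eq 2 (-1) 4 zk w0 (hl z0) (fun hm => S.disj 3 hm (by norm_num) w1) w2 z4
    (by norm_num) (by norm_num) (by norm_num) (by norm_num)
    (fun x hx => S.disj 4 hx (by norm_num))
  norm_num at e1 e2
  have s1 : M 5 ⊆ M 4 := (S.comp 4).resolve_left fun hs => w5 (hs w2)
  have s2 : M 5 ⊆ M 6 := (S.comp 5).resolve_right fun hs => w'5 (hs (p6 ▸ w2'))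
  obtain ⟨v, hv⟩ := S.nonempty 5
  have v3 : v ∈ M 3 := e1 ▸ s1 hv
  exact S.disj 7 v3 (by norm_num) (e2 ▸ s2 hv)

theorem false_of_source (S : QSystem h M) (S' : QSystem h (fun a => M (-a))) (h2 : 2 ≤ h)
    (hr : M 0 ⊆ M 1) (hl : M 0 ⊆ M (-1)) : False := by
  obtain ⟨k, z, w, R⟩ := S.exists_rightEnd h2 hr hl
  have hr' : M (-0) ⊆ M (-1) := by simpa using hl
  have hl' : M (-0) ⊆ M (-(-1)) := by simpa using hr
  obtain ⟨l, z', w', R'⟩ := S'.exists_rightEnd h2 hr' hl'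
  have k1 := R.pos
  have k2 := R.le
  have l1 := R'.pos
  have l2 := R'.le
  by_cases h5 : 5 ≤ h
  · obtain ⟨a1, a2⟩ := R.mem_two S h5 hr hl
    obtain ⟨b1, b2⟩ := R'.mem_two S' h5 hr' hl'
    have z0' := R'.z0
    norm_num at b2 z0'
    exact S.cross 0 2 (-2) R.z0 z0' a1 b2 b1 a2 (by norm_num) (by norm_num; omega) (by norm_num)
      (by norm_num; omega) (by norm_num; omega)
  have hh : h = 3 ∨ h = 4 := by omega
  rcases hh with rfl | rfl
  · have hk : k = 1 := by omega
    have hl : l = 1 := by omega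
    subst hk hl
    have w0 := R.w0
    have w2 := R.w2
    have w0' := R'.w0
    have w2' := R'.w2
    norm_num at *
    have p : M (-3) = M 4 := S.per' (by norm_num)
    rw [p] at w2'
    rcases S.comp 3 with hs | hs
    · exact S.disj 4 w0 (by norm_num) (hs w2)
    · exact S.disj 3 w0' (by norm_num) (hs w2')
  · have hk : k = 1 ∨ k = 2 := by omega
    have hl : l = 1 ∨ l = 2 := by omega
    have RR : RightEnd 4 (fun a => M (- -a)) k z w := by simpa using R
    rcases hk with rfl | rfl <;> rcases hl with rfl | rfl
    · exact S.four_one_one S' hr ‹_› R R'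
    · exact S'.four_two_one hr' hl' R' RR
    · exact S.four_two_one hr ‹_› R R'
    · exact S.four_two_two hr ‹_› R R'

end QSystem

theorem OddHole.exists_trace_subsingleton (H : OddHole G I L c) :
    ∃ i, (trace G I c i).Subsingleton := by
  by_contra hc
  push Not at hc
  have hQ : ∀ i, ∃ w ∈ trace G I c i, ∃ z ∈ trace G I c i, w ≠ z := fun i => hc i
  obtain ⟨h, hL⟩ := H.odd
  have h5 := H.five
  have fin : ∀ i, (trace G I c i).Finite := fun i => I.finite_toSet.subset fun z hz => hz.1
  -- a trace of minimum size is contained in the traces two steps away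
  obtain ⟨n, ⟨a, ha⟩, hmin⟩ : ∃ n, (∃ a, (trace G I c a).ncard = n) ∧
      ∀ b, n ≤ (trace G I c b).ncard := by
    classical
    have hex : ∃ n, ∃ a, (trace G I c a).ncard = n := ⟨_, 0, rfl⟩
    exact ⟨Nat.find hex, Nat.find_spec hex, fun b => Nat.find_min' hex ⟨b, rfl⟩⟩
  have sub : ∀ b, (trace G I c a ⊆ trace G I c b ∨ trace G I c b ⊆ trace G I c a) →
      trace G I c a ⊆ trace G I c b := by
    rintro b (hs | hs)
    · exact hs
    · exact (Set.eq_of_subset_of_ncard_le hs (ha ▸ hmin b) (fin a)).ge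
  have H' := H.shift a
  have S := H'.qSystem hL fun i => hQ (i + a)
  have S' := H'.reflect.qSystem hL fun i => hQ (-i + a)
  refine QSystem.false_of_source S (by simpa [trace] using S') (by omega) ?_ ?_
  · simp only [OddHole.trace_shift, mul_zero, zero_add]
    refine sub _ ?_
    have := S.comp 0
    simpa [OddHole.trace_shift] using this
  · simp only [OddHole.trace_shift, mul_zero, zero_add]
    refine sub _ ?_
    have := (S.comp (-1)).symm
    simpa [OddHole.trace_shift] using this

end SimpleGraph

namespace SimpleGraph

variable {V : Type} {G : SimpleGraph V} {I : Finset V} {L : ℤ} {c : ℤ → V}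

theorem MaxInd.pair_false (hI : MaxInd G I) {x y z : V} (hxy : x ≠ y) (nxy : ¬ G.Adj x y)
    (hx : x ∉ I) (hy : y ∉ I) (tx : ∀ t ∈ I, G.Adj x t → t = z)
    (ty : ∀ t ∈ I, G.Adj y t → t = z) : False := by
  classical
  have := hI.card_le {x, y} {z} (by simp [nxy, G.adj_comm y x]) (by simp [hx, hy])
    (by simpa using ⟨tx, ty⟩)
  rw [Finset.card_pair hxy] at this
  simp at this

theorem MaxInd.triple_false (hI : MaxInd G I) {x y w a b : V} (hxy : x ≠ y) (hxw : x ≠ w)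
    (hyw : y ≠ w) (nxy : ¬ G.Adj x y) (nxw : ¬ G.Adj x w) (nyw : ¬ G.Adj y w)
    (hx : x ∉ I) (hy : y ∉ I) (hw : w ∉ I) (tx : ∀ t ∈ I, G.Adj x t → t = a ∨ t = b)
    (ty : ∀ t ∈ I, G.Adj y t → t = a ∨ t = b) (tw : ∀ t ∈ I, G.Adj w t → t = a ∨ t = b) :
    False := by
  classical
  have := hI.card_le {x, y, w} {a, b}
    (by simp [nxy, nxw, nyw, G.adj_comm y x, G.adj_comm w x, G.adj_comm w y]) (by simp [hx, hy, hw])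
    (by simpa using ⟨tx, ty, tw⟩)
  rw [Finset.card_eq_three.2 ⟨x, y, w, hxy, hxw, hyw, rfl⟩] at this
  have := Finset.card_le_two (a := a) (b := b)
  omega

theorem MinCex.fork_or (h : MinCex G) {v a b p p' q q' : V} (va : G.Adj v a) (vb : G.Adj v b)
    (vp : G.Adj v p) (vq : G.Adj v q) (pp : G.Adj p p') (qq : G.Adj q q') (ne : a ≠ b) :
    G.Adj a p' ∨ G.Adj b p' ∨ G.Adj q p' ∨ G.Adj a q' ∨ G.Adj b q' ∨ G.Adj p q' ∨ G.Adj p' q' := by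
  by_contra hc
  simp only [not_or] at hc
  obtain ⟨h1, h2, h3, h4, h5, h6, h7⟩ := hc
  exact h.fork_false ⟨va, vb, vp, vq, pp, qq, ne, h1, h2, h3, h4, h5, h6, h7⟩

namespace OddHole

theorem trace_pair_false (H : OddHole G I L c) {i j : ℤ} {z : V} (h1 : i + 2 ≤ j)
    (h2 : j + 2 ≤ i + L) (hi : ∀ t ∈ trace G I c i, t = z) (hj : ∀ t ∈ trace G I c j, t = z) :
    False :=
  H.maxInd.pair_false (H.ne i j (by omega) (by omega)) (H.nadj i j h1 h2) (H.notMem i) (H.notMem j)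
    (fun t ht h => hi t ⟨ht, h⟩) (fun t ht h => hj t ⟨ht, h⟩)

theorem trace_triple_false (H : OddHole G I L c) {i j k : ℤ} {a b : V} (h1 : i + 2 ≤ j)
    (h2 : j + 2 ≤ k) (h3 : k + 2 ≤ i + L) (hi : ∀ t ∈ trace G I c i, t = a ∨ t = b)
    (hj : ∀ t ∈ trace G I c j, t = a ∨ t = b) (hk : ∀ t ∈ trace G I c k, t = a ∨ t = b) : False :=
  H.maxInd.triple_false (H.ne i j (by omega) (by omega)) (H.ne i k (by omega) (by omega))
    (H.ne j k (by omega) (by omega)) (H.nadj i j h1 (by omega)) (H.nadj i k (by omega) (by omega))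
    (H.nadj j k h2 (by omega)) (H.notMem i) (H.notMem j) (H.notMem k)
    (fun t ht h => hi t ⟨ht, h⟩) (fun t ht h => hj t ⟨ht, h⟩) (fun t ht h => hk t ⟨ht, h⟩)

/-- The common part of the configurations with `N 0 = {z}`, `N (-1) = {u}` and `N 2 = {z, u}`, in
which `N 1` has two elements, one of them in `N 3`. -/
theorem false_of_shared_pair (H : OddHole G I L c) {z u a b : V} (h0 : trace G I c 0 = {z})
    (hm : trace G I c (-1) = {u}) (hz2 : z ∈ trace G I c 2) (hu2 : u ∈ trace G I c 2)
    (ha1 : a ∈ trace G I c 1) (hb1 : b ∈ trace G I c 1)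
    (hb3 : b ∈ trace G I c 3) (hab : a ≠ b)
    (hc : ∀ t, G.Adj a t → ¬ G.Adj b t → G.Adj (c 0) t → G.Adj u t →
      (∀ y ∈ I, y ≠ t) → False) : False := by
  have h5 := H.five
  have hz0 : z ∈ trace G I c 0 := by simp [h0]
  have hum : u ∈ trace G I c (-1) := by simp [hm]
  have tri : ∀ {x y w : V}, G.Adj x y → G.Adj y w → ¬ G.Adj x w := H.cex.tri
  have n1 : ∀ {x}, x ∈ trace G I c 1 → x ∉ trace G I c 0 ∧ x ∉ trace G I c 2 := fun hx =>
    ⟨fun h => H.disjoint_trace (H.adj 0) h hx, fun h => H.disjoint_trace (H.adj 1) hx h⟩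
  have n1m : ∀ {x}, x ∈ trace G I c 1 → x ∉ trace G I c (-1) := by
    intro x hx hx'
    rw [hm] at hx'
    rw [Set.mem_singleton_iff.1 hx'] at hx
    exact (n1 hx).2 hu2
  have u0 : u ∉ trace G I c 0 := fun h => H.disjoint_trace (H.adj_sub_one 0) h hum
  have am1 : G.Adj (c 0) (c (-1)) := H.adj_sub_one 0
  have a01 : G.Adj (c 0) (c 1) := H.adj 0
  have a12 : G.Adj (c 1) (c 2) := H.adj 1
  have a23 : G.Adj (c 2) (c 3) := H.adj 2
  have nu1 : ¬ G.Adj (c 1) u := tri a12 hu2.2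
  have n03 : ¬ G.Adj (c 0) (c 3) := H.nadj 0 3 (by omega) (by omega)
  have nm2 : ¬ G.Adj (c (-1)) (c 2) := H.nadj (-1) 2 (by omega) (by omega)
  obtain ⟨t, hat, hbt⟩ := H.cex.exists_adj_not_adj hab
  have tI : ∀ y ∈ I, y ≠ t := fun y hy e => H.maxInd.ind a ha1.1 t (e ▸ hy) hat
  have na0 := not_adj_of_notMem ha1 (n1 ha1).1
  have nb0 := not_adj_of_notMem hb1 (n1 hb1).1
  have nam := not_adj_of_notMem ha1 (n1m ha1)
  have nbm := not_adj_of_notMem hb1 (n1m hb1)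
  have nu0 := not_adj_of_notMem hum u0
  have nbz := H.not_adj hb1 hz0
  have nbu := H.not_adj hb1 hum
  have nau := H.not_adj ha1 hum
  have nzu := H.not_adj hz0 hum
  have t1 : ¬ G.Adj t (c 1) := fun h => tri hat h ha1.2.symm
  have c0t : ¬ G.Adj (c 0) t := by
    intro h0t
    have := H.cex.fork_or hz0.2 h0t am1 a01 hum.2 hb1.2 (tI z hz0.1)
    have hut : G.Adj u t := by
      simp only [G.adj_comm] at *
      tauto
    exact hc t hat hbt h0t hut tI
  have c2t : ¬ G.Adj (c 2) t := by
    intro h2t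
    have := H.cex.fork_or hu2.2 h2t a23 hz2.2 hb3.2 hz0.2.symm (tI u hum.1)
    simp only [G.adj_comm] at *
    tauto
  have f1 := H.cex.fork_or a01.symm hb1.2 a12 ha1.2 hu2.2 hat
    (fun e => H.notMem 0 (e ▸ hb1.1))
  have f2 := H.cex.fork_or a12 hb1.2 a01.symm ha1.2 am1 hat
    (fun e => H.notMem 2 (e ▸ hb1.1))
  have f3 := tri hum.2 (w := t)
  simp only [G.adj_comm] at *
  tauto

end OddHole

end SimpleGraph

namespace SimpleGraph

variable {V : Type} {G : SimpleGraph V} {I : Finset V} {c : ℤ → V}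

theorem OddHole.false_of_five_of_three_singletons (H : OddHole G I 5 c) {z₀ z₃ z₄ x : V}
    (h0 : trace G I c 0 = {z₀}) (h4 : trace G I c 4 = {z₄}) (h3 : trace G I c 3 = {z₃})
    (h2 : trace G I c 2 = {z₀, z₄}) (hz1 : z₃ ∈ trace G I c 1) (hx1 : x ∈ trace G I c 1)
    (hxz : x ≠ z₃) : False := by
  have hz0 : z₀ ∈ trace G I c 0 := by simp [h0]
  have hz4 : z₄ ∈ trace G I c 4 := by simp [h4]
  have hz3 : z₃ ∈ trace G I c 3 := by simp [h3]
  have hz02 : z₀ ∈ trace G I c 2 := by simp [h2]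
  have hz42 : z₄ ∈ trace G I c 2 := by simp [h2]
  have tri : ∀ {x y w : V}, G.Adj x y → G.Adj y w → ¬ G.Adj x w := H.cex.tri
  have a01 : G.Adj (c 0) (c 1) := H.adj 0
  have a12 : G.Adj (c 1) (c 2) := H.adj 1
  have a23 : G.Adj (c 2) (c 3) := H.adj 2
  have a34 : G.Adj (c 3) (c 4) := H.adj 3
  have a40 : G.Adj (c 4) (c 0) := by
    have := H.adj 4
    rwa [show (4 : ℤ) + 1 = 0 + 5 by norm_num, H.per] at this
  have c02 := H.nadj 0 2 (by norm_num) (by norm_num)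
  have c03 := H.nadj 0 3 (by norm_num) (by norm_num)
  have c13 := H.nadj 1 3 (by norm_num) (by norm_num)
  have c24 := H.nadj 2 4 (by norm_num) (by norm_num)
  have z03 := H.not_adj hz0 hz3
  have z04 := H.not_adj hz0 hz4
  have z34 := H.not_adj hz3 hz4
  have x0 := H.not_adj hx1 hz0
  have x3 := H.not_adj hx1 hz3
  have x4 := H.not_adj hx1 hz4
  have cz10 : ¬ G.Adj (c 1) z₀ := tri a12 hz02.2
  have cz14 : ¬ G.Adj (c 1) z₄ := tri a12 hz42.2
  have cz04 : ¬ G.Adj (c 0) z₄ := tri a40.symm hz4.2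
  have cz03 : ¬ G.Adj (c 0) z₃ := tri a01 hz1.2
  have cz23 : ¬ G.Adj (c 2) z₃ := tri a12.symm hz1.2
  have cz30 : ¬ G.Adj (c 3) z₀ := tri a23.symm hz02.2
  have cz34 : ¬ G.Adj (c 3) z₄ := tri a34 hz4.2
  have cz40 : ¬ G.Adj (c 4) z₀ := tri a40 hz0.2
  have cz43 : ¬ G.Adj (c 4) z₃ := tri a34.symm hz3.2
  have cx0 : ¬ G.Adj (c 0) x := tri a01 hx1.2
  have cx2 : ¬ G.Adj (c 2) x := tri a12.symm hx1.2
  have ne : ∀ {y} (i : ℤ), y ∈ I → y ≠ c i := fun i hy e => H.notMem i (e ▸ hy)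
  have ne04 : z₀ ≠ z₄ := fun e => cz04 (e ▸ hz0.2)
  have mem_of_eq : ∀ {i : ℤ} {T : Set V}, trace G I c i = T → ∀ y ∈ I, G.Adj (c i) y → y ∈ T :=
    fun e y hy h => e ▸ ⟨hy, h⟩
  have cx3 : ¬ G.Adj (c 3) x := fun h => hxz (mem_of_eq h3 x hx1.1 h)
  have cx4 : ¬ G.Adj (c 4) x := fun h => cz14 (mem_of_eq h4 x hx1.1 h ▸ hx1.2)
  obtain ⟨t, hxt, hzt⟩ := H.cex.exists_adj_not_adj hxz
  have tI : t ∉ I := fun h => H.maxInd.ind x hx1.1 t h hxt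
  have t1 : ¬ G.Adj t (c 1) := fun h => tri hxt h hx1.2.symm
  have t2 : ¬ G.Adj t (c 2) := by
    intro h
    have := H.cex.fork_or (v := c 2) hz02.2 hz42.2 a23 h.symm hz3.2 hxt.symm ne04
    simp only [G.adj_comm] at *
    tauto
  have ht0 : G.Adj t (c 0) := by
    have f1 := H.cex.fork_or (v := c 1) a01.symm hz1.2 a12 hx1.2 hz42.2 hxt (ne 0 hz1.1).symm
    have f2 := H.cex.fork_or (v := c 1) a12 hz1.2 a01.symm hx1.2 a40.symm hxt (ne 2 hz1.1).symm
    have := tri hz4.2 (w := t)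
    simp only [G.adj_comm] at *
    tauto
  have tz0 : ¬ G.Adj t z₀ := tri ht0 hz0.2
  have t4 : ¬ G.Adj t (c 4) := tri ht0 a40.symm
  have htz4 : G.Adj t z₄ := by
    have := H.cex.fork_or (v := c 0) hz0.2 ht0.symm a01 a40.symm hz1.2 hz4.2
      (fun e => tI (e ▸ hz0.1))
    simp only [G.adj_comm] at *
    tauto
  have t3 : ¬ G.Adj t (c 3) := by
    intro h
    have := H.cex.fork_or (v := c 3) a34 hz3.2 a23.symm h.symm hz02.2 hxt.symm (ne 4 hz3.1).symm
    simp only [G.adj_comm] at *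
    tauto
  obtain ⟨s, hzs, hs1⟩ := H.cex.exists_adj_not_adj (ne 1 hz0.1)
  have sI : s ∉ I := fun h => H.maxInd.ind z₀ hz0.1 s h hzs
  have s0 : ¬ G.Adj (c 0) s := tri hz0.2 hzs
  have s2 : ¬ G.Adj (c 2) s := tri hz02.2 hzs
  have g1 := H.cex.fork_or (v := c 2) a12.symm a23 hz02.2 hz42.2 hzs htz4.symm
    (H.ne 1 3 (by norm_num) (by norm_num))
  have g2 := H.cex.fork_or (v := c 2) a23 hz42.2 a12.symm hz02.2 hx1.2 hzs (ne 3 hz42.1).symm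
  have g3 := H.cex.fork_or (v := c 0) a01 ht0.symm a40.symm hz0.2 a34.symm hzs
    (fun e => t2 (e ▸ a12))
  have g4 := H.cex.fork_or (v := c 0) a40.symm ht0.symm a01 hz0.2 hz1.2 hzs
    (fun e => t3 (e ▸ a34.symm))
  have r1 := tri hz3.2 (w := s)
  have r2 := tri hz4.2 (w := s)
  have r3 := tri htz4 (w := s)
  have r4 := tri hxt (w := s)
  have r5 := tri a34 (w := s)
  have sz3 : ¬ G.Adj s z₃ := by
    intro h
    grind [G.adj_comm]
  have sx : ¬ G.Adj s x := by
    intro h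
    grind [G.adj_comm]
  have sI' : ∀ y ∈ I, G.Adj s y → y = z₀ ∨ y = z₄ := by
    intro y hy hsy
    by_contra hne
    rw [not_or] at hne
    have hst : G.Adj s t ∧ G.Adj s (c 3) := by
      grind [G.adj_comm]
    have := H.cex.fork_or (v := s) hzs.symm hsy hst.2 hst.1 hz3.2 htz4 (Ne.symm hne.1)
    have := H.maxInd.ind y hy z₃ hz3.1
    have := H.maxInd.ind y hy z₄ hz4.1
    grind [G.adj_comm]
  refine H.maxInd.triple_false (x := s) (y := c 2) (w := c 0) (a := z₀) (b := z₄)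
    (fun e => hs1 (e ▸ a12)) (fun e => hs1 (e ▸ a01.symm))
    (H.ne 0 2 (by norm_num) (by norm_num)).symm
    (fun h => s2 h.symm) (fun h => s0 h.symm) (fun h => c02 h.symm) sI (H.notMem 2) (H.notMem 0)
    sI' (fun y hy h => ?_) (fun y hy h => ?_)
  · exact mem_of_eq h2 y hy h
  · exact Or.inl (mem_of_eq h0 y hy h)

end SimpleGraph

namespace SimpleGraph

variable {V : Type} {G : SimpleGraph V} {I : Finset V} {L : ℤ} {c : ℤ → V}

namespace OddHole

theorem trace_eq_singleton (H : OddHole G I L c) {i : ℤ} (hi : (trace G I c i).Subsingleton) :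
    ∃ z, trace G I c i = {z} :=
  (Set.exists_eq_singleton_iff_nonempty_subsingleton).2 ⟨H.trace_nonempty i, hi⟩

/-- The start of the analysis of a vertex `c 0` with a single neighbour in `I` that is followed by
a vertex with several ones. -/
theorem mixed_start (H : OddHole G I L c) {z : V} (h0 : trace G I c 0 = {z})
    (h1 : (trace G I c 1).Nontrivial) :
    z ∈ trace G I c 2 ∧ (trace G I c 2).Nontrivial ∧ ∃ u, trace G I c (-1) = {u} ∧
      (trace G I c 2 = {z, u} ∨ ∃ v, v ≠ u ∧ trace G I c 1 = {u, v}) := by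
  have h5 := H.five
  obtain ⟨a, ha, b, hb, hab⟩ := h1
  have hz0 : z ∈ trace G I c 0 := by simp [h0]
  have t0 : ∀ t ∈ trace G I c 0, t = z := by simp [h0]
  have e0 : (1 : ℤ) - 1 = 0 := by norm_num
  have e2 : (1 : ℤ) + 1 = 2 := by norm_num
  have comp := H.trace_comparable ha hb hab
  rw [e0, e2] at comp
  have notsub : ¬ ∀ t ∈ trace G I c 2, t = z := fun h =>
    H.trace_pair_false (i := 0) (j := 2) (by omega) (by omega) t0 h
  have hz2 : z ∈ trace G I c 2 := by
    rcases comp with h | h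
    · exact h hz0
    · exact (notsub fun t ht => t0 t (h ht)).elim
  push Not at notsub
  obtain ⟨y, hy, hyz⟩ := notsub
  have hm : (trace G I c (-1)).Subsingleton := by
    by_contra hm
    rw [Set.not_subsingleton_iff] at hm
    obtain ⟨p, hp, q, hq, hpq⟩ := hm
    have comp := H.trace_comparable hp hq hpq
    norm_num at comp
    have hzm : z ∈ trace G I c (-2) := by
      rcases comp with h | h
      · obtain ⟨t, ht⟩ := H.trace_nonempty (-2)
        exact t0 t (h ht) ▸ ht
      · exact h hz0
    exact H.swap 0 z hz0.1 hz0.2 (fun t ht h => t0 t ⟨ht, h⟩) hz2.2 hzm.2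
  obtain ⟨u, hu⟩ := H.trace_eq_singleton hm
  have hum : u ∈ trace G I c (-1) := by simp [hu]
  refine ⟨hz2, ⟨y, hy, z, hz2, hyz⟩, u, hu, ?_⟩
  by_cases hα : ∀ w ∈ trace G I c 2, w = z ∨ w = u
  · left
    have : y = u := (hα y hy).resolve_left hyz
    subst this
    ext w
    constructor
    · exact hα w
    · rintro (rfl | rfl)
      · exact hz2
      · exact hy
  · right
    push Not at hα
    obtain ⟨w, hw, hwz, hwu⟩ := hα
    have back : ∀ a ∈ trace G I c 1, ∀ b ∈ trace G I c 1, a ≠ b → a = u ∨ b = u := by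
      intro a ha b hb hab
      by_contra hne
      rw [not_or] at hne
      refine H.fork_two_back (i := 1) (w := w) ha hb hab ?_ ?_ ?_ ?_ ?_ <;> norm_num <;>
        simp [*]
    have hu1 : u ∈ trace G I c 1 := by
      rcases back a ha b hb hab with rfl | rfl
      · exact ha
      · exact hb
    obtain ⟨v, hv, hvu⟩ : ∃ v ∈ trace G I c 1, v ≠ u := by
      rcases back a ha b hb hab with rfl | rfl
      · exact ⟨b, hb, hab.symm⟩
      · exact ⟨a, ha, hab⟩
    refine ⟨v, hvu, ?_⟩
    ext x
    simp only [Set.mem_insert_iff, Set.mem_singleton_iff]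
    constructor
    · intro hx
      by_cases hxv : x = v
      · exact Or.inr hxv
      · exact Or.inl ((back x hx v hv hxv).resolve_right hvu)
    · rintro (rfl | rfl)
      · exact hu1
      · exact hv

theorem mixed_left_false (H : OddHole G I L c) (h7 : 7 ≤ L) {z u v : V}
    (h0 : trace G I c 0 = {z}) (hu : trace G I c (-1) = {u}) (hz2 : z ∈ trace G I c 2)
    (h2 : (trace G I c 2).Nontrivial) (hvu : v ≠ u) (h1 : trace G I c 1 = {u, v}) : False := by
  have hum : u ∈ trace G I c (-1) := by simp [hu]
  have hz0 : z ∈ trace G I c 0 := by simp [h0]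
  have hu1 : u ∈ trace G I c 1 := by simp [h1]
  have hv1 : v ∈ trace G I c 1 := by simp [h1]
  have tm : ∀ t ∈ trace G I c (-1), t = u := by simp [hu]
  have comp : trace G I c 1 ⊆ trace G I c 3 ∨ trace G I c 3 ⊆ trace G I c 1 := by
    obtain ⟨p, hp, q, hq, hpq⟩ := h2
    exact H.trace_comparable hp hq hpq
  by_cases h3 : (trace G I c 3).Subsingleton
  · obtain ⟨z', hz'⟩ := H.trace_eq_singleton h3
    have hz1 : z' ∈ trace G I c 1 := by
      rcases comp with h | h
      · rw [hz'] at h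
        exact (hvu ((h hv1 : v = z').trans (h hu1 : u = z').symm)).elim
      · exact h (by simp [hz'])
    have hne : z' ≠ u := by
      rintro rfl
      exact H.trace_pair_false (i := -1) (j := 3) (by omega) (by omega) tm (by simp [hz'])
    have : z' = v := by
      rw [h1] at hz1
      exact hz1.resolve_left hne
    subst this
    refine H.trace_triple_false (i := -1) (j := 1) (k := 3) (a := u) (b := z') (by omega) (by omega)
      (by omega) ?_ ?_ ?_
    · simp [hu]
    · simp [h1]
    · simp [hz']
  · rw [Set.not_subsingleton_iff] at h3
    have hu3 : u ∈ trace G I c 3 := by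
      rcases comp with h | h
      · exact h hu1
      · obtain ⟨p, hp, q, hq, hpq⟩ := h3
        have h1p := h hp
        have h1q := h hq
        rw [h1] at h1p h1q
        rcases h1p with rfl | rfl
        · exact hp
        · rcases h1q with rfl | h'
          · exact hq
          · exact (hpq h'.symm).elim
    obtain ⟨x, hx3, hxu⟩ := h3.exists_ne u
    obtain ⟨y, hy2, hyz⟩ := h2.exists_ne z
    have hxm : x ∉ trace G I c (-1) := by simpa [hu] using hxu
    have hy0 : y ∉ trace G I c 0 := by simpa [h0] using hyz
    have step : ∀ i j w y, w ∈ trace G I c i → y ∈ trace G I c i → trace G I c j = {w} →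
        y ∉ trace G I c j → ¬ G.Adj (c (i - 1)) (c j) → ¬ G.Adj (c (i + 1)) (c j) →
        trace G I c (i + 1) = trace G I c (i - 1) := by
      intro i j w y hw hy hj hyj n1 n2
      refine H.trace_eq_of_separated hw hy (by simp [hj]) hyj n1 n2 ?_
      intro t ht
      rw [hj] at ht
      rw [Set.mem_singleton_iff.1 ht]
      exact ⟨fun h => H.disjoint_trace (H.adj_sub_one i) hw h,
        fun h => H.disjoint_trace (H.adj i) hw h⟩
    obtain ⟨n, hn⟩ := H.odd
    have alt : ∀ k : ℤ, 1 ≤ k → k + 1 ≤ n → trace G I c (2 * k) = trace G I c 2 ∧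
        trace G I c (2 * k + 1) = trace G I c 3 := by
      intro k hk
      induction k, hk using Int.leInduction with
      | base => exact fun _ => ⟨by norm_num, by norm_num⟩
      | succ k hk ih =>
        intro hkn
        obtain ⟨i1, i2⟩ := ih (by omega)
        have e1 : trace G I c (2 * k + 1 + 1) = trace G I c (2 * k + 1 - 1) := by
          refine step (2 * k + 1) (-1) u x (i2 ▸ hu3) (i2 ▸ hx3) hu hxm ?_ ?_
          · exact fun h => H.nadj (-1) _ (by omega) (by omega) h.symm
          · exact fun h => H.nadj (-1) _ (by omega) (by omega) h.symm
        have e1' : trace G I c (2 * (k + 1)) = trace G I c 2 := by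
          rw [← i1]
          convert e1 using 2 <;> ring
        have e2 : trace G I c (2 * (k + 1) + 1) = trace G I c (2 * (k + 1) - 1) := by
          refine step (2 * (k + 1)) 0 z y (e1' ▸ hz2) (e1' ▸ hy2) h0 hy0 ?_ ?_
          · exact fun h => H.nadj 0 _ (by omega) (by omega) h.symm
          · exact fun h => H.nadj 0 _ (by omega) (by omega) h.symm
        refine ⟨e1', ?_⟩
        rw [e2, ← i2]
        congr 1
        ring
    obtain ⟨i1, i2⟩ := alt (n - 1) (by omega) (by omega)
    have el : trace G I c (2 * (n - 1) + 1 + 1) = trace G I c (-1) := by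
      rw [← H.trace_per (-1)]
      congr 1
      omega
    have e1 : trace G I c (2 * (n - 1) + 1 + 1) = trace G I c (2 * (n - 1) + 1 - 1) := by
      refine step (2 * (n - 1) + 1) (-1) u x (i2 ▸ hu3) (i2 ▸ hx3) hu hxm ?_ ?_
      · exact fun h => H.nadj (-1) _ (by omega) (by omega) h.symm
      · have : c (2 * (n - 1) + 1 + 1) = c (-1) := by
          rw [← H.per (-1)]
          congr 1
          omega
        rw [this]
        exact G.irrefl
    rw [el, add_sub_cancel_right, i1, hu] at e1
    rw [← e1] at h2
    exact Set.not_nontrivial_singleton h2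

theorem mixed_right_false (H : OddHole G I L c) (h7 : 7 ≤ L) {z u : V}
    (h0 : trace G I c 0 = {z}) (hu : trace G I c (-1) = {u}) (h1 : (trace G I c 1).Nontrivial)
    (h2 : trace G I c 2 = {z, u}) : False := by
  have hum : u ∈ trace G I c (-1) := by simp [hu]
  have hz2 : z ∈ trace G I c 2 := by simp [h2]
  have hu2 : u ∈ trace G I c 2 := by simp [h2]
  have hz0 : z ∈ trace G I c 0 := by simp [h0]
  have hzm : z ∉ trace G I c (-1) := fun h => H.disjoint_trace (H.adj_sub_one 0) hz0 h
  have h31 : trace G I c 3 = trace G I c 1 := by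
    refine H.trace_eq_of_separated (i := 2) (j := -1) hu2 hz2 hum hzm ?_ ?_ ?_
    · exact fun h => H.nadj (-1) 1 (by omega) (by omega) h.symm
    · exact fun h => H.nadj (-1) 3 (by omega) (by omega) h.symm
    · intro t ht
      rw [hu] at ht
      rw [Set.mem_singleton_iff.1 ht]
      exact ⟨fun h => H.disjoint_trace (H.adj_sub_one 2) hu2 h,
        fun h => H.disjoint_trace (H.adj 2) hu2 h⟩
  obtain ⟨a, ha, b, hb, hab⟩ := h1
  have h24 : trace G I c 2 ⊆ trace G I c 4 := by
    refine (H.trace_comparable (i := 3) (h31 ▸ ha) (h31 ▸ hb) hab).resolve_right fun h => ?_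
    have h' : trace G I c 4 ⊆ trace G I c 2 := h
    rw [h2] at h'
    refine H.trace_triple_false (i := 0) (j := 2) (k := 4) (a := z) (b := u) (by omega) (by omega)
      (by omega) ?_ ?_ h'
    · intro t ht
      rw [h0] at ht
      exact Or.inl ht
    · simp [h2]
  refine H.false_of_shared_pair h0 hu hz2 hu2 ha hb (h31 ▸ hb) hab fun t hat hbt h0t hut tI => ?_
  have n1 : ∀ {x}, x ∈ trace G I c 1 → ¬ G.Adj (c (-1)) x := by
    refine fun hx => not_adj_of_notMem hx ?_
    rw [hu]
    rintro rfl
    exact H.disjoint_trace (H.adj 1) hx hu2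
  have nbm := n1 hb
  have nam := n1 ha
  have hb4 : ¬ G.Adj (c 4) b :=
    not_adj_of_notMem hb fun h => H.disjoint_trace (H.adj 3) (h31 ▸ hb) h
  have nm4 := H.nadj (-1) 4 (by omega) (by omega)
  have n14 := H.nadj 1 4 (by omega) (by omega)
  have nbz := H.not_adj hb hz0
  have am1 : G.Adj (c 0) (c (-1)) := H.adj_sub_one 0
  have hmt : c (-1) ≠ t := by
    rintro rfl
    exact nam hat.symm
  have := H.cex.fork_or am1 h0t (H.adj 0) hz0.2 hb.2 (h24 hz2).2.symm hmt
  have h4t : ¬ G.Adj (c 4) t := H.cex.tri (h24 hu2).2 hut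
  grind [G.adj_comm]

/-- On a hole of length at least seven, every vertex has a single neighbour in `I` or none has. -/
theorem mixed_false_of_seven_le (H : OddHole G I L c) (h7 : 7 ≤ L) {z : V}
    (h0 : trace G I c 0 = {z}) (h1 : (trace G I c 1).Nontrivial) : False := by
  obtain ⟨hz2, h2, u, hu, h | ⟨v, hvu, h⟩⟩ := H.mixed_start h0 h1
  · exact H.mixed_right_false h7 h0 hu h1 h
  · exact H.mixed_left_false h7 h0 hu hz2 h2 hvu h

theorem mixed_false_of_five (H : OddHole G I 5 c) {z : V}
    (h0 : trace G I c 0 = {z}) (h1 : (trace G I c 1).Nontrivial) : False := by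
  obtain ⟨hz2, h2, u, hu, hαβ⟩ := H.mixed_start h0 h1
  have h4 : trace G I c 4 = {u} := by
    rw [← hu, ← H.trace_per (-1)]
    rfl
  have hu4 : u ∈ trace G I c 4 := by simp [h4]
  have hz0 : z ∈ trace G I c 0 := by simp [h0]
  have hu3 : u ∉ trace G I c 3 := fun h => H.disjoint_trace (H.adj 3) h hu4
  have comp : trace G I c 1 ⊆ trace G I c 3 ∨ trace G I c 3 ⊆ trace G I c 1 := by
    obtain ⟨p, hp, q, hq, hpq⟩ := h2
    exact H.trace_comparable hp hq hpq
  by_cases h3 : (trace G I c 3).Subsingleton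
  · obtain ⟨z', hz'⟩ := H.trace_eq_singleton h3
    have h31 : z' ∈ trace G I c 1 := by
      rcases comp with h | h
      · exact (h1.mono h).not_subsingleton h3 |>.elim
      · exact h (by simp [hz'])
    rcases hαβ with h | ⟨v, hvu, h⟩
    · obtain ⟨x, hx, hxz⟩ := h1.exists_ne z'
      exact H.false_of_five_of_three_singletons h0 h4 hz' h h31 hx hxz
    · have : z' = v := by
        have : z' ∈ ({u, v} : Set V) := h ▸ h31
        refine this.resolve_left ?_
        rintro rfl
        exact hu3 (by simp [hz'])
      subst this
      obtain ⟨x, hx, hxz⟩ := h2.exists_ne z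
      refine (H.shift 3).reflect.false_of_five_of_three_singletons (z₀ := z') (z₄ := u) (z₃ := z)
        (x := x) ?_ ?_ ?_ ?_ ?_ ?_ hxz
      · exact hz'
      · exact hu
      · exact h0
      · exact h.trans (Set.pair_comm _ _)
      · exact hz2
      · exact hx
  · rw [Set.not_subsingleton_iff] at h3
    obtain ⟨a, ha1, ha3, b, hb1, hb3, hab⟩ : ∃ a, a ∈ trace G I c 1 ∧ a ∈ trace G I c 3 ∧
        ∃ b, b ∈ trace G I c 1 ∧ b ∈ trace G I c 3 ∧ a ≠ b := by
      rcases comp with h | h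
      · obtain ⟨a, ha, b, hb, hab⟩ := h1
        exact ⟨a, ha, h ha, b, hb, h hb, hab⟩
      · obtain ⟨a, ha, b, hb, hab⟩ := h3
        exact ⟨a, h ha, ha, b, h hb, hb, hab⟩
    rcases hαβ with h | ⟨v, hvu, h⟩
    · have hu2 : u ∈ trace G I c 2 := by simp [h]
      refine H.false_of_shared_pair h0 hu hz2 hu2 ha1 hb1 hb3 hab fun t hat hbt h0t hut tI => ?_
      have a23 : G.Adj (c 3) (c 2) := (H.adj 2).symm
      have a34 : G.Adj (c 3) (c 4) := H.adj 3
      have h40 : G.Adj (c 4) (c 0) := by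
        have := H.adj 4
        rwa [show (4 : ℤ) + 1 = 0 + 5 by norm_num, H.per] at this
      have hb4 : b ≠ c 4 := fun e => H.notMem 4 (e ▸ hb1.1)
      have := H.cex.fork_or a34 hb3.2 a23 ha3.2 hz2.2 hat hb4.symm
      have n1 := H.cex.tri h40 hz0.2
      have n2 := H.not_adj hb1 hz0
      have n3 := H.not_adj ha1 hz0
      have n4 := H.cex.tri hu4.2 hut
      have n5 := H.cex.tri hu2.2 hut
      have n6 := H.cex.tri hz0.2.symm h0t
      tauto
    · rw [h] at ha1 hb1
      have : a = v := ha1.resolve_left fun e => hu3 (e ▸ ha3)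
      have : b = v := hb1.resolve_left fun e => hu3 (e ▸ hb3)
      simp_all

theorem mixed_false (H : OddHole G I L c) {z : V}
    (h0 : trace G I c 0 = {z}) (h1 : (trace G I c 1).Nontrivial) : False := by
  by_cases h7 : 7 ≤ L
  · exact H.mixed_false_of_seven_le h7 h0 h1
  · have h5 := H.five
    obtain ⟨n, hn⟩ := H.odd
    obtain rfl : L = 5 := by omega
    exact H.mixed_false_of_five h0 h1

/-- Every vertex of the hole has exactly one neighbour in `I`. -/
theorem trace_subsingleton (H : OddHole G I L c) (i : ℤ) : (trace G I c i).Subsingleton := by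
  obtain ⟨i₀, h₀⟩ := H.exists_trace_subsingleton
  have h5 := H.five
  have up : ∀ j, i₀ ≤ j → (trace G I c j).Subsingleton := by
    intro j hj
    induction j, hj using Int.leInduction with
    | base => exact h₀
    | succ j hj ih =>
      by_contra hn
      rw [Set.not_subsingleton_iff] at hn
      obtain ⟨z, hz⟩ := H.trace_eq_singleton ih
      refine (H.shift j).mixed_false (z := z) ?_ ?_
      · rw [trace_shift, zero_add, hz]
      · rwa [trace_shift, add_comm]
  have e : c i = c (i + (|i| + |i₀|) * L) := (H.per_mul _ _).symm
  have : trace G I c i = trace G I c (i + (|i| + |i₀|) * L) := by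
    simp only [trace, ← e]
  rw [this]
  apply up
  have := neg_abs_le i
  have := le_abs_self i₀
  have := abs_nonneg i₀
  have := abs_nonneg i
  nlinarith

end OddHole

end SimpleGraph

namespace SimpleGraph

variable {V : Type} {G : SimpleGraph V} {I : Finset V} {L : ℤ} {c z : ℤ → V}

namespace OddHole

theorem trace_adj_iff (hz : ∀ i, trace G I c i = {z i}) {w : V} (hw : w ∈ I) (i : ℤ) :
    G.Adj (c i) w ↔ w = z i := by
  have : w ∈ trace G I c i ↔ w = z i := by simp [hz]
  rw [← this]
  exact ⟨fun h => ⟨hw, h⟩, fun h => h.2⟩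

theorem mem_of_trace_eq (hz : ∀ i, trace G I c i = {z i}) (i : ℤ) : z i ∈ I := by
  have : z i ∈ trace G I c i := by simp [hz]
  exact this.1

theorem attach_ne (H : OddHole G I L c) (hz : ∀ i, trace G I c i = {z i}) {i j : ℤ}
    (hij : c i ≠ c j) : z i ≠ z j := by
  intro e
  by_cases h : G.Adj (c i) (c j)
  · exact H.disjoint_trace (z := z i) h (by simp [hz]) (by simp [hz, e])
  · exact H.maxInd.pair_false (z := z i) hij h (H.notMem i) (H.notMem j)
      (fun t ht h => (trace_adj_iff hz ht i).1 h)
      (fun t ht h => e ▸ (trace_adj_iff hz ht j).1 h)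

theorem cubic_aux (H : OddHole G I L c) (hz : ∀ i, trace G I c i = {z i}) {y w : V}
    (h0y : G.Adj (c 0) y) (hw : w ∈ I) (hyw : G.Adj y w) (w1 : w ≠ z 1) (wm : w ≠ z (-1))
    (w2 : w ≠ z 2) : False := by
  have h5 := H.five
  have cz : ∀ i j, G.Adj (c i) (z j) ↔ z j = z i := fun i j =>
    trace_adj_iff hz (mem_of_trace_eq hz j) i
  have cw : ∀ i, G.Adj (c i) w ↔ w = z i := trace_adj_iff hz hw
  have am : G.Adj (c 0) (c (-1)) := H.adj_sub_one 0
  have a01 : G.Adj (c 0) (c 1) := H.adj 0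
  have a12 : G.Adj (c 1) (c 2) := H.adj 1
  have m2 := H.nadj (-1) 2 (by omega) (by omega)
  have d01 := H.attach_ne hz (H.ne 0 1 (by omega) (by omega))
  have d02 := H.attach_ne hz (H.ne 0 2 (by omega) (by omega))
  have dm1 := H.attach_ne hz (H.ne (-1) 1 (by omega) (by omega))
  have zz : ∀ i j, ¬ G.Adj (z i) (z j) := fun i j =>
    H.maxInd.ind _ (mem_of_trace_eq hz i) _ (mem_of_trace_eq hz j)
  have zw : ∀ i, ¬ G.Adj (z i) w := fun i => H.maxInd.ind _ (mem_of_trace_eq hz i) _ hw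
  have c0z : G.Adj (c 0) (z 0) := (cz 0 0).2 rfl
  have w0 : ¬ G.Adj (c 0) w := H.cex.tri h0y hyw
  have ne : c (-1) ≠ z 0 := fun e => H.notMem (-1) (e ▸ mem_of_trace_eq hz 0)
  have y1 : G.Adj y (z 1) := by
    have := H.cex.fork_or am c0z a01 h0y ((cz 1 1).2 rfl) hyw ne
    grind [G.adj_comm]
  have y2 : G.Adj y (c 2) := by
    have := H.cex.fork_or am c0z a01 h0y a12 hyw ne
    grind [G.adj_comm]
  have := H.cex.fork_or y1 hyw h0y.symm y2 c0z ((cz 2 2).2 rfl) w1.symm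
  grind [G.adj_comm]

theorem cubic_zero (H : OddHole G I L c) (hz : ∀ i, trace G I c i = {z i}) {y : V}
    (h0y : G.Adj (c 0) y) (h1 : y ≠ c 1) (hm : y ≠ c (-1)) : y = z 0 := by
  by_contra hy0
  have h5 := H.five
  have hyI : y ∉ I := fun h => hy0 ((trace_adj_iff hz h 0).1 h0y)
  refine H.maxInd.triple_false (x := y) (y := c 1) (w := c (-1)) (a := z 1) (b := z (-1)) h1 hm
    (H.ne (-1) 1 (by omega) (by omega)).symm (H.cex.tri h0y.symm (H.adj 0))
    (H.cex.tri h0y.symm (H.adj_sub_one 0))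
    (fun h => H.nadj (-1) 1 (by omega) (by omega) h.symm) hyI (H.notMem _) (H.notMem _)
    ?_ (fun t ht h => Or.inl ((trace_adj_iff hz ht 1).1 h))
    (fun t ht h => Or.inr ((trace_adj_iff hz ht (-1)).1 h))
  intro w hw hyw
  by_contra hne
  rw [not_or] at hne
  by_cases w2 : w = z 2
  · refine H.reflect.cubic_aux (z := fun i => z (-i)) (fun i => hz (-i)) h0y hw hyw hne.2 ?_ ?_
    · simpa using hne.1
    · rw [w2]
      exact H.attach_ne hz (H.ne (-2) 2 (by omega) (by omega)).symm
  · exact H.cubic_aux hz h0y hw hyw hne.1 hne.2 w2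

end OddHole

/-- An odd hole in a minimal counterexample each of whose vertices `c i` has exactly one neighbour
`z i` off the hole, these being pairwise distinct and nonadjacent. -/
structure CubicHole (G : SimpleGraph V) (L : ℤ) (c z : ℤ → V) : Prop where
  cex : MinCex G
  five : 5 ≤ L
  adj : ∀ i, G.Adj (c i) (c (i + 1))
  per : ∀ i k, c (i + k * L) = c i
  eq_iff : ∀ i j, c i = c j ↔ ∃ k, j = i + k * L
  adj_attach : ∀ i, G.Adj (c i) (z i)
  attach_eq_iff : ∀ i j, z i = z j ↔ c i = c j
  attach_nadj : ∀ i j, ¬ G.Adj (z i) (z j)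
  attach_ne : ∀ i j, z i ≠ c j
  eq_of_adj : ∀ i y, G.Adj (c i) y → y = c (i + 1) ∨ y = c (i - 1) ∨ y = z i

theorem MinCex.exists_cubicHole [Fintype V] (h : MinCex G) : ∃ L c z, CubicHole G L c z := by
  obtain ⟨I, L, c, H⟩ := h.exists_oddHole
  choose z hz using fun i => H.trace_eq_singleton (H.trace_subsingleton i)
  have mem := OddHole.mem_of_trace_eq hz
  refine ⟨L, c, z, h, H.five, H.adj, H.per_mul, fun i j => H.eq_iff, ?_, ?_, ?_, ?_, ?_⟩
  · exact fun i => (OddHole.trace_adj_iff hz (mem i) i).2 rfl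
  · refine fun i j => ⟨fun e => ?_, fun e => ?_⟩
    · by_contra hne
      exact H.attach_ne hz hne e
    · exact (OddHole.trace_adj_iff hz (mem i) j).1
        (e ▸ (OddHole.trace_adj_iff hz (mem i) i).2 rfl)
  · exact fun i j => H.maxInd.ind _ (mem i) _ (mem j)
  · exact fun i j e => H.notMem j (e ▸ mem i)
  · intro i y hy
    by_contra hne
    simp only [not_or] at hne
    refine hne.2.2 ?_
    have := (H.shift i).cubic_zero (z := fun j => z (j + i)) (fun j => hz (j + i)) (y := y)
      (by simpa using hy) (by simpa [add_comm] using hne.1)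
      (by simpa [neg_add_eq_sub] using hne.2.1)
    simpa using this

end SimpleGraph

namespace SimpleGraph

theorem exists_avoiding_color (x y : Fin 3) : ∃ d, d ≠ x ∧ d ≠ y := by
  revert x y
  decide

/-- A cycle with lists of two colours out of three, given by forbidding the colour `h i` at `i`, can
be coloured unless all the lists agree. -/
theorem exists_cycle_coloring {L : ℤ} (hL : 2 ≤ L) {h : ℤ → Fin 3} (per : ∀ i, h (i + L) = h i)
    {i j : ℤ} (hij : h i ≠ h j) :
    ∃ g : ℤ → Fin 3, (∀ i k, g (i + k * L) = g i) ∧ (∀ i, g i ≠ h i) ∧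
      ∀ i, g i ≠ g (i + 1) := by
  obtain ⟨m, hm⟩ : ∃ m, h m ≠ h (m + 1) := by
    by_contra hc
    push Not at hc
    have : ∀ k : ℤ, h k = h 0 := by
      intro k
      induction k using Int.induction_on with
      | zero => rfl
      | succ k ih => rw [← hc, ih]
      | pred k ih => rw [hc, sub_add_cancel, ih]
    exact hij ((this i).trans (this j).symm)
  have per_mul : ∀ i k, h (i + k * L) = h i := by
    intro i k
    induction k using Int.induction_on with
    | zero => simp
    | succ k ih => rw [add_one_mul, ← add_assoc, per, ih]
    | pred k ih => rw [← per, ← ih]; congr 1; ring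
  choose avoid av1 av2 using exists_avoiding_color
  let g' : ℕ → Fin 3 := fun n => Nat.rec (h m) (fun n r => avoid r (h (m + 1 + (n + 1)))) n
  have g's : ∀ n, g' (n + 1) = avoid (g' n) (h (m + 1 + (n + 1))) := fun n => rfl
  have g'h : ∀ n : ℕ, g' n ≠ h (m + 1 + n) := by
    intro n
    cases n with
    | zero =>
      change h m ≠ _
      simpa using hm
    | succ n =>
      rw [g's]
      push_cast
      exact av2 _ _
  refine ⟨fun k => g' ((k - (m + 1)) % L).toNat, fun i k => ?_, fun i => ?_, fun i => ?_⟩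
  · have : i + k * L - (m + 1) = i - (m + 1) + k * L := by ring
    simp only [this, Int.add_mul_emod_self_right]
  all_goals
    have e := Int.emod_add_mul_ediv (i - (m + 1)) L
    have h0 := Int.emod_nonneg (i - (m + 1)) (show L ≠ 0 by omega)
    have h1 := Int.emod_lt_of_pos (i - (m + 1)) (show 0 < L by omega)
    obtain ⟨n, hn⟩ := Int.eq_ofNat_of_zero_le h0
    simp only [hn, Int.toNat_natCast]
  · have := g'h n
    rwa [← per_mul _ ((i - (m + 1)) / L), show m + 1 + n + (i - (m + 1)) / L * L = i by linarith]
      at this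
  · have key : i + 1 - (m + 1) = n + 1 + (i - (m + 1)) / L * L := by linarith
    rw [key, Int.add_mul_emod_self_right]
    by_cases hnL : (n : ℤ) + 1 < L
    · rw [Int.emod_eq_of_lt (by omega) hnL]
      have : ((n : ℤ) + 1).toNat = n + 1 := by omega
      rw [this, g's]
      exact (av1 _ _).symm
    · have hnL : (n : ℤ) + 1 = L := by omega
      rw [hnL, Int.emod_self]
      have := g'h n
      rw [show m + 1 + (n : ℤ) = m + L by omega, per] at this
      exact this

variable {V : Type} {G : SimpleGraph V} {L : ℤ} {c z : ℤ → V}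

namespace CubicHole

theorem adj_sub_one (H : CubicHole G L c z) (i : ℤ) : G.Adj (c i) (c (i - 1)) := by
  simpa using (H.adj (i - 1)).symm

theorem succ_ne_pred (H : CubicHole G L c z) (i : ℤ) : c (i + 1) ≠ c (i - 1) := by
  intro e
  have h5 := H.five
  obtain ⟨k, hk⟩ := (H.eq_iff _ _).1 e
  obtain hk0 | hk0 | hk0 : k = 0 ∨ 0 < k ∨ k < 0 := by omega
  · rw [hk0] at hk
    omega
  · nlinarith
  · nlinarith

theorem eq_attach_of_adj (H : CubicHole G L c z) {i : ℤ} {x : V} (hx : ∀ k, x ≠ c k)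
    (h : G.Adj (c i) x) : x = z i := by
  rcases H.eq_of_adj i x h with h | h | h
  · exact (hx _ h).elim
  · exact (hx _ h).elim
  · exact h

theorem not_adj_attach (H : CubicHole G L c z) {i j : ℤ} (hij : c i ≠ c j) :
    ¬ G.Adj (c i) (z j) := fun h =>
  hij ((H.attach_eq_iff i j).1 (H.eq_attach_of_adj (H.attach_ne j) h).symm)

/-- A colouring off the hole that is not constant on the attachments extends to the hole. -/
theorem attach_color_eq (H : CubicHole G L c z) {f : V → Fin 3}
    (hf : ∀ x y, (∀ k, x ≠ c k) → (∀ k, y ≠ c k) → G.Adj x y → f x ≠ f y) (i j : ℤ) :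
    f (z i) = f (z j) := by
  classical
  by_contra hij
  have per : ∀ i, z (i + L) = z i := fun i => by
    rw [H.attach_eq_iff]
    simpa using H.per i 1
  obtain ⟨g, g1, g2, g3⟩ := exists_cycle_coloring (h := fun i => f (z i))
    (by have := H.five; omega : 2 ≤ L) (fun i => by rw [per]) hij
  let col : V → Fin 3 := fun x => if hx : ∃ k, x = c k then g hx.choose else f x
  have col_c : ∀ k, col (c k) = g k := by
    intro k
    have hx : ∃ k', c k = c k' := ⟨k, rfl⟩
    simp only [col, dif_pos hx]
    obtain ⟨m, hm⟩ := (H.eq_iff _ _).1 hx.choose_spec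
    rw [hm, g1]
  have col_n : ∀ x, (∀ k, x ≠ c k) → col x = f x := by
    intro x hx
    have : ¬ ∃ k, x = c k := by simpa using hx
    simp only [col, dif_neg this]
  have step : ∀ k y, G.Adj (c k) y → col (c k) ≠ col y := by
    intro k y hy
    rcases H.eq_of_adj k y hy with rfl | rfl | rfl
    · rw [col_c, col_c]
      exact g3 k
    · rw [col_c, col_c]
      simpa using (g3 (k - 1)).symm
    · rw [col_c, col_n _ (H.attach_ne k)]
      exact g2 k
  refine H.cex.not_colorable ⟨Coloring.mk col fun {x y} hxy => ?_⟩
  by_cases hx : ∃ k, x = c k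
  · obtain ⟨k, rfl⟩ := hx
    exact step k y hxy
  by_cases hy : ∃ k, y = c k
  · obtain ⟨k, rfl⟩ := hy
    exact (step k x hxy.symm).symm
  push Not at hx hy
  rw [col_n x hx, col_n y hy]
  exact hf x y hx hy hxy

theorem adj_of_ne {E : SimpleGraph V} {x y s t : V}
    (hE : ∀ x y, E.Adj x y ↔ G.Adj x y ∨ (x = s ∧ y = t) ∨ (x = t ∧ y = s))
    (h : E.Adj x y) (hx : x ≠ t) (h' : y ≠ t ∨ x ≠ s) : G.Adj x y := by
  rcases (hE x y).1 h with h | h | h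
  · exact h
  · exact (h'.elim (· h.2) (· h.1)).elim
  · exact (hx h.1).elim

variable {E : SimpleGraph V} {i j : ℤ} {v a b p p' q q' : V}

theorem fork_leaf_false (H : CubicHole G L c z)
    (hE : ∀ x y, E.Adj x y ↔ G.Adj x y ∨ (x = z i ∧ y = z j) ∨ (x = z j ∧ y = z i))
    (hF : IsFork E v a b p p' q q') (hb : ∀ k, b ≠ c k)
    (hp' : ∀ k, p' ≠ c k) (hq' : ∀ k, q' ≠ c k) (hv : v = z i) (ha : a = z j) : False := by
  obtain ⟨va, vb, vp, vq, pp, qq, ne, ap, bp, qp, aq, bq, pq, tt⟩ := hF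
  have bne : b ≠ z j := fun e => ne (ha.trans e.symm)
  have pne : p ≠ z j := fun e => ap (ha.trans e.symm ▸ pp)
  have qne : q ≠ z j := fun e => aq (ha.trans e.symm ▸ qq)
  have pv : p ≠ z i := fun e => vp.ne (hv.trans e.symm)
  have qv : q ≠ z i := fun e => vq.ne (hv.trans e.symm)
  have p'v : p' ≠ z i := fun e => qp (hv.trans e.symm ▸ vq.symm)
  have q'v : q' ≠ z i := fun e => pq (hv.trans e.symm ▸ vp.symm)
  have cp : ¬ G.Adj (c i) p' := fun h => p'v (H.eq_attach_of_adj hp' h)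
  have cq : ¬ G.Adj (c i) q' := fun h => q'v (H.eq_attach_of_adj hq' h)
  have ci : G.Adj v (c i) := hv ▸ (H.adj_attach i).symm
  have vj : v ≠ z j := fun e => va.ne (e.trans ha.symm)
  have nE : ∀ {x y}, ¬ E.Adj x y → ¬ G.Adj x y := fun h h' => h ((hE _ _).2 (Or.inl h'))
  exact H.cex.fork_false ⟨ci, adj_of_ne hE vb vj (.inl bne), adj_of_ne hE vp vj (.inl pne),
    adj_of_ne hE vq vj (.inl qne), adj_of_ne hE pp pne (.inr pv), adj_of_ne hE qq qne (.inr qv),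
    (hb i).symm, cp, nE bp, nE qp, cq, nE bq, nE pq, nE tt⟩

theorem fork_tail_false (H : CubicHole G L c z)
    (hE : ∀ x y, E.Adj x y ↔ G.Adj x y ∨ (x = z i ∧ y = z j) ∨ (x = z j ∧ y = z i))
    (hF : IsFork E v a b p p' q q') (ha : ∀ k, a ≠ c k) (hb : ∀ k, b ≠ c k)
    (hq : ∀ k, q ≠ c k) (hq' : ∀ k, q' ≠ c k) (hp : p = z i) (hp' : p' = z j) : False := by
  obtain ⟨va, vb, vp, vq, pp, qq, ne, ap, bp, qp, aq, bq, pq, tt⟩ := hF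
  have av : a ≠ z i := fun e => ap (hp.trans e.symm ▸ pp)
  have bv : b ≠ z i := fun e => bp (hp.trans e.symm ▸ pp)
  have qv : q ≠ z i := fun e => qp (hp.trans e.symm ▸ pp)
  have q'v : q' ≠ z i := fun e => tt (hp.trans e.symm ▸ pp.symm)
  have vi : v ≠ z i := fun e => vp.ne (e.trans hp.symm)
  have vj : v ≠ z j := fun e => qp (hp'.trans e.symm ▸ vq.symm)
  have ca : ¬ G.Adj (c i) a := fun h => av (H.eq_attach_of_adj ha h)
  have cb : ¬ G.Adj (c i) b := fun h => bv (H.eq_attach_of_adj hb h)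
  have cq : ¬ G.Adj (c i) q := fun h => qv (H.eq_attach_of_adj hq h)
  have cq' : ¬ G.Adj (c i) q' := fun h => q'v (H.eq_attach_of_adj hq' h)
  have ci : G.Adj p (c i) := hp ▸ (H.adj_attach i).symm
  have nE : ∀ {x y}, ¬ E.Adj x y → ¬ G.Adj x y := fun h h' => h ((hE _ _).2 (Or.inl h'))
  exact H.cex.fork_false ⟨adj_of_ne hE va vj (.inr vi), adj_of_ne hE vb vj (.inr vi),
    adj_of_ne hE vp vj (.inr vi), adj_of_ne hE vq vj (.inr vi), ci,
    (adj_of_ne (fun x y => (hE x y).trans (or_congr_right or_comm)) qq qv (.inl q'v)), ne,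
    fun h => ca h.symm, fun h => cb h.symm, fun h => cq h.symm, nE aq, nE bq, nE pq, cq'⟩

theorem fork_arm_false (H : CubicHole G L c z)
    (hE : ∀ x y, E.Adj x y ↔ G.Adj x y ∨ (x = z i ∧ y = z j) ∨ (x = z j ∧ y = z i))
    (hF : IsFork E v a b p p' q q') (ha : ∀ k, a ≠ c k) (hb : ∀ k, b ≠ c k)
    (hq : ∀ k, q ≠ c k) (hq' : ∀ k, q' ≠ c k) (hv : v = z i) (hp : p = z j) : False := by
  obtain ⟨va, vb, vp, vq, pp, qq, ne, ap, bp, qp, aq, bq, pq, tt⟩ := hF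
  have av : a ≠ z j := fun e => ap (hp.trans e.symm ▸ pp)
  have bv : b ≠ z j := fun e => bp (hp.trans e.symm ▸ pp)
  have qne : q ≠ z j := fun e => qp (hp.trans e.symm ▸ pp)
  have qv : q ≠ z i := fun e => vq.ne (hv.trans e.symm)
  have q'v : q' ≠ z i := fun e => aq (hv.trans e.symm ▸ va.symm)
  have vj : v ≠ z j := fun e => vp.ne (e.trans hp.symm)
  have cq' : ¬ G.Adj (c i) q' := fun h => q'v (H.eq_attach_of_adj hq' h)
  have ci : G.Adj v (c i) := hv ▸ (H.adj_attach i).symm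
  have nE : ∀ {x y}, ¬ E.Adj x y → ¬ G.Adj x y := fun h h' => h ((hE _ _).2 (Or.inl h'))
  have va' := adj_of_ne hE va vj (.inl av)
  have vb' := adj_of_ne hE vb vj (.inl bv)
  have vq' := adj_of_ne hE vq vj (.inl qne)
  have qq' := adj_of_ne hE qq qne (.inr qv)
  have nz : ∀ {x}, (∀ k, x ≠ c k) → G.Adj v x → ∀ k, ¬ G.Adj x (c k) := by
    intro x hx hvx k h
    rw [H.eq_attach_of_adj hx h.symm, hv] at hvx
    exact H.attach_nadj _ _ hvx
  have hk : ∀ k, G.Adj (c i) (c k) → q' = z k := by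
    intro k hk
    by_contra hne
    exact H.cex.fork_false ⟨va', vb', ci, vq', hk, qq', ne, nz ha va' k, nz hb vb' k, nz hq vq' k,
      nE aq, nE bq, cq', fun h => hne (H.eq_attach_of_adj hq' h)⟩
  exact H.succ_ne_pred i ((H.attach_eq_iff _ _).1
    ((hk _ (H.adj i)).symm.trans (hk _ (H.adj_sub_one i))))

/-- Any two attachments of the hole have a common neighbour. -/
theorem exists_common (H : CubicHole G L c z) (i j : ℤ) (hij : c i ≠ c j) :
    ∃ y, G.Adj (z i) y ∧ G.Adj (z j) y := by
  by_contra hno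
  push Not at hno
  have zij : z i ≠ z j := fun e => hij ((H.attach_eq_iff i j).1 e)
  let E : SimpleGraph V := G ⊔ edge (z i) (z j)
  have hE : ∀ x y, E.Adj x y ↔ G.Adj x y ∨ (x = z i ∧ y = z j) ∨ (x = z j ∧ y = z i) := by
    intro x y
    simp only [E, sup_adj, edge_adj]
    grind
  have hE' : ∀ x y, E.Adj x y ↔ G.Adj x y ∨ (x = z j ∧ y = z i) ∨ (x = z i ∧ y = z j) := by
    intro x y
    rw [hE, or_congr_right or_comm]
  have hS : {x | ∀ k, x ≠ c k} ≠ Set.univ := fun e =>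
    (e ▸ Set.mem_univ (c 0) : c 0 ∈ {x | ∀ k, x ≠ c k}) 0 rfl
  suffices good : GoodOn E {x | ∀ k, x ≠ c k} by
    obtain ⟨f, hf⟩ := H.cex.small E _ hS good
    refine hf (z i) (H.attach_ne i) (z j) (H.attach_ne j) ((hE _ _).2 (by simp)) ?_
    exact H.attach_color_eq (fun x y hx hy hxy => hf x hx y hy ((hE x y).2 (Or.inl hxy))) i j
  refine ⟨?_, ?_⟩
  · intro x hx y hy w hw h1 h2 h3
    have tri := H.cex.tri (a := x) (b := y) (c := w)
    have n1 := h1.ne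
    have n2 := h2.ne
    have n3 := h3.ne
    simp only [hE] at h1 h2 h3
    clear hE hE' hS hx hy hw
    grind [G.adj_comm]
  · intro v hv a ha b hb p hp p' hp' q hq q' hq' hF
    have swap : IsFork E v b a p p' q q' := by
      obtain ⟨va, vb, vp, vq, pp, qq, ne, ap, bp, qp, aq, bq, pq, tt⟩ := hF
      exact ⟨vb, va, vp, vq, pp, qq, ne.symm, bp, ap, qp, bq, aq, pq, tt⟩
    have turn : IsFork E v a b q q' p p' := by
      obtain ⟨va, vb, vp, vq, pp, qq, ne, ap, bp, qp, aq, bq, pq, tt⟩ := hF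
      exact ⟨va, vb, vq, vp, qq, pp, ne, aq, bq, pq, ap, bp, qp, fun h => tt h.symm⟩
    have va : G.Adj v a := by
      rcases (hE _ _).1 hF.va with h | ⟨h1, h2⟩ | ⟨h1, h2⟩
      · exact h
      · exact (H.fork_leaf_false hE hF hb hp' hq' h1 h2).elim
      · exact (H.fork_leaf_false hE' hF hb hp' hq' h1 h2).elim
    have vb : G.Adj v b := by
      rcases (hE _ _).1 hF.vb with h | ⟨h1, h2⟩ | ⟨h1, h2⟩
      · exact h
      · exact (H.fork_leaf_false hE swap ha hp' hq' h1 h2).elim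
      · exact (H.fork_leaf_false hE' swap ha hp' hq' h1 h2).elim
    have vp : G.Adj v p := by
      rcases (hE _ _).1 hF.vp with h | ⟨h1, h2⟩ | ⟨h1, h2⟩
      · exact h
      · exact (H.fork_arm_false hE hF ha hb hq hq' h1 h2).elim
      · exact (H.fork_arm_false hE' hF ha hb hq hq' h1 h2).elim
    have vq : G.Adj v q := by
      rcases (hE _ _).1 hF.vq with h | ⟨h1, h2⟩ | ⟨h1, h2⟩
      · exact h
      · exact (H.fork_arm_false hE turn ha hb hp hp' h1 h2).elim
      · exact (H.fork_arm_false hE' turn ha hb hp hp' h1 h2).elim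
    have pp : G.Adj p p' := by
      rcases (hE _ _).1 hF.pp with h | ⟨h1, h2⟩ | ⟨h1, h2⟩
      · exact h
      · exact (H.fork_tail_false hE hF ha hb hq hq' h1 h2).elim
      · exact (H.fork_tail_false hE' hF ha hb hq hq' h1 h2).elim
    have qq : G.Adj q q' := by
      rcases (hE _ _).1 hF.qq with h | ⟨h1, h2⟩ | ⟨h1, h2⟩
      · exact h
      · exact (H.fork_tail_false hE turn ha hb hp hp' h1 h2).elim
      · exact (H.fork_tail_false hE' turn ha hb hp hp' h1 h2).elim
    have nE : ∀ {x y}, ¬ E.Adj x y → ¬ G.Adj x y := fun h h' => h ((hE _ _).2 (Or.inl h'))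
    exact H.cex.fork_false ⟨va, vb, vp, vq, pp, qq, hF.ne, nE hF.ap, nE hF.bp, nE hF.qp, nE hF.aq,
      nE hF.bq, nE hF.pq, nE hF.tt⟩

end CubicHole

end SimpleGraph

namespace SimpleGraph

/-- The incidences between five attachments and their common neighbours: any two of the five points
lie on a common line, no line contains four of them, and every point lies on one of any two lines
through another one. -/
structure FiveSystem {V : Type} (R : Fin 5 → V → Prop) : Prop where
  common : ∀ i j, i ≠ j → ∃ y, R i y ∧ R j y
  four : ∀ y i j k l, [i, j, k, l].Nodup → R i y → R j y → R k y → ¬ R l y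
  cover : ∀ i j, i ≠ j → ∀ y₁ y₂, y₁ ≠ y₂ → R i y₁ → R i y₂ → R j y₁ ∨ R j y₂

namespace FiveSystem

variable {V : Type} {R : Fin 5 → V → Prop}

theorem eq_of_three (h : FiveSystem R) {i : Fin 5} {y₁ y₂ y₃ : V} (h1 : R i y₁) (h2 : R i y₂)
    (h3 : R i y₃) : y₁ = y₂ ∨ y₁ = y₃ ∨ y₂ = y₃ := by
  by_contra hne
  simp only [not_or] at hne
  obtain ⟨h12, h13, h23⟩ := hne
  obtain ⟨a, b, d, e, hn⟩ : ∃ a b d e, [i, a, b, d, e].Nodup :=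
    ⟨i + 1, i + 2, i + 3, i + 4, by clear h1 h2 h3; decide +revert⟩
  have two : ∀ j, i ≠ j → (R j y₁ ∨ R j y₂) ∧ (R j y₁ ∨ R j y₃) ∧ (R j y₂ ∨ R j y₃) :=
    fun j hj => ⟨h.cover i j hj y₁ y₂ h12 h1 h2, h.cover i j hj y₁ y₃ h13 h1 h3,
      h.cover i j hj y₂ y₃ h23 h2 h3⟩
  simp only [List.nodup_cons, List.mem_cons, List.not_mem_nil, or_false, not_or, not_false_eq_true,
    List.nodup_nil, and_true] at hn
  have three : ∀ y, R i y → ¬ (R a y ∧ R b y ∧ R d y) ∧ ¬ (R a y ∧ R b y ∧ R e y) ∧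
      ¬ (R a y ∧ R d y ∧ R e y) ∧ ¬ (R b y ∧ R d y ∧ R e y) := by
    intro y hy
    have := h.four y
    simp only [List.nodup_cons, List.mem_cons, List.not_mem_nil, or_false, not_or,
      not_false_eq_true, List.nodup_nil, and_true] at this
    refine ⟨fun ⟨p, q, r⟩ => ?_, fun ⟨p, q, r⟩ => ?_, fun ⟨p, q, r⟩ => ?_, fun ⟨p, q, r⟩ => ?_⟩
    · exact this i a b d (by grind) hy p q r
    · exact this i a b e (by grind) hy p q r
    · exact this i a d e (by grind) hy p q r
    · exact this i b d e (by grind) hy p q r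
  have ta := two a (by tauto)
  have tb := two b (by tauto)
  have td := two d (by tauto)
  have te := two e (by tauto)
  have l1 := three y₁ h1
  have l2 := three y₂ h2
  have l3 := three y₃ h3
  clear two three h12 h13 h23 h hn
  grind

theorem third (h : FiveSystem R) {i b d e : Fin 5} (hn : [i, b, d, e].Nodup) {y : V}
    (hi : R i y) : R b y ∨ R d y ∨ R e y := by
  by_contra hne
  simp only [not_or] at hne
  obtain ⟨hb, hd, he⟩ := hne
  obtain ⟨y₁, i1, b1⟩ := h.common i b (by grind)
  obtain ⟨y₂, i2, d2⟩ := h.common i d (by grind)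
  obtain ⟨y₃, i3, e3⟩ := h.common i e (by grind)
  have e1 := h.eq_of_three hi i1 i2
  have e2 := h.eq_of_three hi i1 i3
  have := h.four y₁ i b d e (by grind)
  grind

theorem line_false (h : FiveSystem R) {i a b d e : Fin 5} (hn : [i, a, b, d, e].Nodup) {y : V}
    (hi : R i y) (ha : R a y) (hb : R b y) : False := by
  have nd : ¬ R d y := h.four y i a b d (by grind) hi ha hb
  have ne : ¬ R e y := h.four y i a b e (by grind) hi ha hb
  obtain ⟨y₂, i2, d2⟩ := h.common i d (by grind)
  have e2 : R e y₂ := by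
    obtain ⟨y', i', e'⟩ := h.common i e (by grind)
    have := h.eq_of_three hi i2 i'
    grind
  obtain ⟨y₃, a3, d3⟩ := h.common a d (by grind)
  obtain ⟨y₄, a4, e4⟩ := h.common a e (by grind)
  obtain ⟨y₅, b5, d5⟩ := h.common b d (by grind)
  have t := h.third (i := a) (b := i) (d := b) (e := e) (by grind) a3
  have f1 := h.four y₃ a b d e (by grind)
  have f2 := h.four y₂ i a d e (by grind)
  have f3 := h.four y₂ i b d e (by grind)
  have t1 := h.eq_of_three ha a3 a4
  have t2 := h.eq_of_three d2 d3 d5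
  have t3 := fun x => h.eq_of_three hi i2 (y₃ := y₃) x
  grind

theorem false (h : FiveSystem R) : False := by
  obtain ⟨y, h0, h1⟩ := h.common 0 1 (by decide)
  rcases h.third (b := 2) (d := 3) (e := 4) (by decide) h0 with h' | h' | h'
  · exact h.line_false (d := 3) (e := 4) (by decide) h0 h1 h'
  · exact h.line_false (d := 2) (e := 4) (by decide) h0 h1 h'
  · exact h.line_false (d := 2) (e := 3) (by decide) h0 h1 h'

end FiveSystem

variable {V : Type} {G : SimpleGraph V} {L : ℤ} {c z : ℤ → V}

namespace CubicHole

theorem not_four (H : CubicHole G L c z) {y : V} {i j k l : ℤ} (hij : c i ≠ c j) (hik : c i ≠ c k)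
    (hil : c i ≠ c l) (hjk : c j ≠ c k) (hjl : c j ≠ c l) (hkl : c k ≠ c l) (hi : G.Adj (z i) y)
    (hj : G.Adj (z j) y) (hk : G.Adj (z k) y) (hl : G.Adj (z l) y) : False := by
  have adj_of : ∀ {i j k l : ℤ}, c i ≠ c j → c i ≠ c k → c i ≠ c l → c j ≠ c k → c j ≠ c l →
      c k ≠ c l → G.Adj (z i) y → G.Adj (z j) y → G.Adj (z k) y → G.Adj (z l) y →
      G.Adj (c i) (c j) := by
    intro i j k l hij hik hil hjk hjl hkl hi hj hk hl
    by_contra hc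
    have n : ∀ {i j : ℤ}, c i ≠ c j → ¬ G.Adj (z j) (c i) := fun h h' =>
      H.not_adj_attach h h'.symm
    exact H.cex.fork_false ⟨hk.symm, hl.symm, hi.symm, hj.symm, (H.adj_attach i).symm,
      (H.adj_attach j).symm, fun e => hkl ((H.attach_eq_iff k l).1 e), n hik, n hil, n hij, n hjk,
      n hjl, n hij.symm, hc⟩
  exact H.cex.tri (adj_of hij hik hil hjk hjl hkl hi hj hk hl)
    (adj_of hjk hij.symm hjl hik.symm hkl hil hj hk hi hl)
    (adj_of hik hij hil hjk.symm hkl hjl hi hk hj hl)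

theorem cover (H : CubicHole G L c z) {i j : ℤ} (hij : c i ≠ c j) {y₁ y₂ y₃ : V}
    (m1 : ∀ k, y₁ ≠ c k) (m2 : ∀ k, y₂ ≠ c k) (m3 : ∀ k, y₃ ≠ c k) (h23 : y₂ ≠ y₃)
    (h1 : G.Adj (z i) y₁) (h2 : G.Adj (z i) y₂) (h3 : G.Adj (z i) y₃) (hj : G.Adj (z j) y₁) :
    G.Adj (z j) y₂ ∨ G.Adj (z j) y₃ := by
  by_contra hne
  rw [not_or] at hne
  have n : ∀ {y}, (∀ k, y ≠ c k) → G.Adj (z i) y → ∀ k, ¬ G.Adj y (c k) := by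
    intro y hy hiy k h
    rw [H.eq_attach_of_adj hy h.symm] at hiy
    exact H.attach_nadj _ _ hiy
  have key : ∀ k, G.Adj (c i) (c k) → c k = c j := by
    intro k hk
    by_contra hkj
    exact H.cex.fork_false ⟨h2, h3, (H.adj_attach i).symm, h1, hk, hj.symm, h23, n m2 h2 k,
      n m3 h3 k, n m1 h1 k, fun h => hne.1 h.symm, fun h => hne.2 h.symm, H.not_adj_attach hij,
      H.not_adj_attach hkj⟩
  exact H.succ_ne_pred i ((key _ (H.adj i)).trans (key _ (H.adj_sub_one i)).symm)

theorem fiveSystem (H : CubicHole G L c z) :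
    FiveSystem fun (i : Fin 5) y => G.Adj (z (i : ℕ)) y ∧ ∀ k, y ≠ c k := by
  have h5 := H.five
  have inj : ∀ {i j : Fin 5}, i ≠ j → c (i : ℕ) ≠ c (j : ℕ) := by
    intro i j hij e
    obtain ⟨k, hk⟩ := (H.eq_iff _ _).1 e
    have := i.2
    have := j.2
    obtain hk0 | hk0 | hk0 : k = 0 ∨ 0 < k ∨ k < 0 := by omega
    · rw [hk0] at hk
      exact hij (Fin.ext (by omega))
    · nlinarith
    · nlinarith
  have common : ∀ i j : Fin 5, i ≠ j → ∃ y, (G.Adj (z (i : ℕ)) y ∧ ∀ k, y ≠ c k) ∧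
      G.Adj (z (j : ℕ)) y ∧ ∀ k, y ≠ c k := by
    intro i j hij
    obtain ⟨y, hi, hj⟩ := H.exists_common _ _ (inj hij)
    have hy : ∀ k, y ≠ c k := by
      rintro k rfl
      by_cases hk : c k = c (i : ℕ)
      · exact H.not_adj_attach (hk ▸ inj hij) hj.symm
      · exact H.not_adj_attach hk hi.symm
    exact ⟨y, ⟨hi, hy⟩, hj, hy⟩
  refine ⟨common, ?_, ?_⟩
  · intro y i j k l hn hi hj hk hl
    exact H.not_four (inj (by grind)) (inj (by grind)) (inj (by grind)) (inj (by grind))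
      (inj (by grind)) (inj (by grind)) hi.1 hj.1 hk.1 hl.1
  · intro i j hij y₁ y₂ h12 h1 h2
    obtain ⟨y, ⟨hi, hy⟩, hj, -⟩ := common i j hij
    exact (H.cover (inj hij) hy h1.2 h2.2 h12 hi h1.1 h2.1 hj).imp (⟨·, h1.2⟩) (⟨·, h2.2⟩)

end CubicHole

end SimpleGraph

theorem triangle_free_fork_free_vizing_bound {V : Type} [Fintype V]
    (G : SimpleGraph V) (h1 : G.CliqueFree 3) (h2 : ForkFree G) :
    G.chromaticNumber ≤ (G.cliqueNum : ℕ∞) + 1 := by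
  refine chromaticNumber_le_of_colorable_three
    (exists_minCex_or_colorable _ G rfl (goodOn_univ h1 h2) fun H hH => ?_)
  obtain ⟨L, c, z, hole⟩ := hH.exists_cubicHole
  exact hole.fiveSystem.false
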